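/- arXiv:1710.07022 — 3 statements merged into one kernel-verified Lean document; each statement's English description precedes it below -/
import Mathlib

section
/- Let Ω = D(0,1) be the open unit disc in ℝ², let 0 < β < 1, and let B_β(x₁,x₂) = β² − (x₁²+x₂²). Then the function ψ₀(x₁,x₂) = (1/16)·(x₁²+x₂²+1−4β²)·(1−x₁²−x₂²) satisfies Δψ₀ = B_β in D(0,1) and ψ₀ = 0 on ∂D(0,1), and lim_{h→0⁺} h·log Λ^D(h,B_β,D(0,1)) equals −(1/8)(2β²−1)² if β ∈ (0,1/2), equals −(1/2)β⁴ if β ∈ [1/2, 1/√2], and equals −(1/8)(4β²−1) if β ∈ (1/√2, 1). -/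
open MeasureTheory Set Filter Topology

noncomputable section

/-- First partial derivative (in the direction `x₁`) of a function on `ℝ × ℝ`. -/
def pd1 {E : Type*} [NormedAddCommGroup E] [NormedSpace ℝ E] (u : ℝ × ℝ → E) (x : ℝ × ℝ) : E :=
  fderiv ℝ u x (1, 0)

/-- Second partial derivative (in the direction `x₂`) of a function on `ℝ × ℝ`. -/
def pd2 {E : Type*} [NormedAddCommGroup E] [NormedSpace ℝ E] (u : ℝ × ℝ → E) (x : ℝ × ℝ) : E :=
  fderiv ℝ u x (0, 1)

/-- The Laplacian on `ℝ × ℝ`. -/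
def lap (ψ : ℝ × ℝ → ℝ) (x : ℝ × ℝ) : ℝ := pd1 (pd1 ψ) x + pd2 (pd2 ψ) x

/-- Test functions for the Dirichlet variational problems on `Ω`:
nonzero smooth compactly supported functions with support in `Ω`. -/
def IsTestFun (Ω : Set (ℝ × ℝ)) (u : ℝ × ℝ → ℂ) : Prop :=
  ContDiff ℝ (⊤ : ℕ∞) u ∧ HasCompactSupport u ∧ tsupport u ⊆ Ω ∧ u ≠ 0

/-- Rayleigh quotient of the spin-`σ` (`σ = -1` : spin-down, `σ = 1` : spin-up)
Dirichlet Pauli operator at the test function `u`. -/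
def pauliRayleigh (σ : ℝ) (h : ℝ) (A : ℝ × ℝ → ℝ × ℝ) (B : ℝ × ℝ → ℝ) (Ω : Set (ℝ × ℝ))
    (u : ℝ × ℝ → ℂ) : ℝ :=
  ((∫ x in Ω, (‖(h : ℂ) * pd1 u x - Complex.I * ((A x).1 : ℂ) * u x‖ ^ 2
      + ‖(h : ℂ) * pd2 u x - Complex.I * ((A x).2 : ℂ) * u x‖ ^ 2))
    + σ * (h * ∫ x in Ω, B x * ‖u x‖ ^ 2)) / ∫ x in Ω, ‖u x‖ ^ 2

/-- The ground state energy `λ₋^D(h,A,B,Ω)` of the spin-down Dirichlet Pauli operator. -/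
def lambdaMinusD (h : ℝ) (A : ℝ × ℝ → ℝ × ℝ) (B : ℝ × ℝ → ℝ) (Ω : Set (ℝ × ℝ)) : ℝ :=
  sInf (pauliRayleigh (-1) h A B Ω '' {u | IsTestFun Ω u})

/-- The ground state energy `λ₊^D(h,A,B,Ω)` of the spin-up Dirichlet Pauli operator. -/
def lambdaPlusD (h : ℝ) (A : ℝ × ℝ → ℝ × ℝ) (B : ℝ × ℝ → ℝ) (Ω : Set (ℝ × ℝ)) : ℝ :=
  sInf (pauliRayleigh 1 h A B Ω '' {u | IsTestFun Ω u})

/-- The ground state energy `Λ^D(h,A,B,Ω)` of the full Dirichlet Pauli operator. -/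
def LambdaD (h : ℝ) (A : ℝ × ℝ → ℝ × ℝ) (B : ℝ × ℝ → ℝ) (Ω : Set (ℝ × ℝ)) : ℝ :=
  min (lambdaMinusD h A B Ω) (lambdaPlusD h A B Ω)

/-- The canonical vector potential `∇⊥ψ = (−∂₂ψ, ∂₁ψ)`. -/
def perpGrad (ψ : ℝ × ℝ → ℝ) (x : ℝ × ℝ) : ℝ × ℝ := (-(pd2 ψ x), pd1 ψ x)

/-- `ψ` is the scalar potential of `B` on `Ω`: `ψ ∈ C⁰(closure Ω) ∩ C²(Ω)`,
`Δψ = B` in `Ω` and `ψ = 0` on `∂Ω`. -/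
structure IsScalarPotential (Ω : Set (ℝ × ℝ)) (B : ℝ × ℝ → ℝ) (ψ : ℝ × ℝ → ℝ) : Prop where
  contOn : ContinuousOn ψ (closure Ω)
  c2 : ContDiffOn ℝ 2 ψ Ω
  lap_eq : ∀ x ∈ Ω, lap ψ x = B x
  bdry : ∀ x ∈ frontier Ω, ψ x = 0

/-- `A` is a continuous vector potential for `B` on `Ω`: `∂₁A₂ − ∂₂A₁ = B`. -/
def IsVectorPotential (Ω : Set (ℝ × ℝ)) (B : ℝ × ℝ → ℝ) (A : ℝ × ℝ → ℝ × ℝ) : Prop :=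
  ContinuousOn A Ω ∧ ∀ x ∈ Ω, pd1 (fun y => (A y).2) x - pd2 (fun y => (A y).1) x = B x

/-- `γ` is a regular curve of class `C^{2,α}` on the parameter set `s`. -/
def C2HolderOn (α : ℝ) (γ : ℝ → ℝ × ℝ) (s : Set ℝ) : Prop :=
  ContDiffOn ℝ 2 γ s ∧
  (∃ C : ℝ, ∀ x ∈ s, ∀ y ∈ s,
      ‖derivWithin (derivWithin γ s) s x - derivWithin (derivWithin γ s) s y‖ ≤ C * |x - y| ^ α) ∧
  ∀ x ∈ s, derivWithin γ s x ≠ 0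

/-- Near `p`, the set `Γ` is a regular curve of class `C^{2,α}`. -/
def IsLocallyC2CurveAt (α : ℝ) (Γ : Set (ℝ × ℝ)) (p : ℝ × ℝ) : Prop :=
  ∃ ε > 0, ∃ γ : ℝ → ℝ × ℝ, C2HolderOn α γ (Icc (-1) 1) ∧ γ 0 = p ∧
    Γ ∩ Metric.ball p ε = γ '' Ioo (-1) 1 ∩ Metric.ball p ε

/-- `Γ` is (locally) a regular curve of class `C^{2,α}`. -/
def IsC2HolderSet (α : ℝ) (Γ : Set (ℝ × ℝ)) : Prop := ∀ p ∈ Γ, IsLocallyC2CurveAt α Γ p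

/-- `Ω` has a corner at `p` formed by two `C^{2,α}` arcs, of aperture less than `π`
(near `p`, `Ω` is contained in a strictly convex open cone with vertex `p`). -/
def HasConvexCornerAt (Ω : Set (ℝ × ℝ)) (α : ℝ) (p : ℝ × ℝ) : Prop :=
  ∃ ε > 0, (∃ γ₁ γ₂ : ℝ → ℝ × ℝ, C2HolderOn α γ₁ (Icc 0 1) ∧ C2HolderOn α γ₂ (Icc 0 1) ∧
      γ₁ 0 = p ∧ γ₂ 0 = p ∧
      frontier Ω ∩ Metric.ball p ε = (γ₁ '' Ico 0 1 ∪ γ₂ '' Ico 0 1) ∩ Metric.ball p ε) ∧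
    ∃ w : ℝ × ℝ, ∃ c > 0, ∀ x ∈ Ω ∩ Metric.ball p ε,
      c * ‖x - p‖ ≤ (x - p).1 * w.1 + (x - p).2 * w.2

/-- `Ω` has a continuous boundary which is piecewise of class `C^{2,α}` for some `α > 0`,
with at most finitely many corners, each of aperture less than `π`. -/
def HasPiecewiseC2Boundary (Ω : Set (ℝ × ℝ)) : Prop :=
  ∃ α > 0, ∃ S : Finset (ℝ × ℝ), ↑S ⊆ frontier Ω ∧
    (∀ p ∈ frontier Ω \ (S : Set (ℝ × ℝ)), IsLocallyC2CurveAt α (frontier Ω) p) ∧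
    ∀ p ∈ S, HasConvexCornerAt Ω α p

/-- Assumption (R): `Ω` is bounded and open with continuous, piecewise `C^{2,α}` boundary
having finitely many corners of aperture `< π`, and `B` extends continuously to `closure Ω`. -/
structure AssumptionR (Ω : Set (ℝ × ℝ)) (B : ℝ × ℝ → ℝ) : Prop where
  isOpen : IsOpen Ω
  bounded : Bornology.IsBounded Ω
  bdryReg : HasPiecewiseC2Boundary Ω
  fieldCont : ContinuousOn B (closure Ω)

/-- The oscillation of `ψ` over `Ω`. -/
def osc (ψ : ℝ × ℝ → ℝ) (Ω : Set (ℝ × ℝ)) : ℝ := sSup (ψ '' Ω) - sInf (ψ '' Ω)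

/-- The region enclosed by `Γ`: the union of the bounded connected components of `Γᶜ`. -/
def curveInterior (Γ : Set (ℝ × ℝ)) : Set (ℝ × ℝ) :=
  {x | x ∉ Γ ∧ Bornology.IsBounded (connectedComponentIn Γᶜ x)}

/-- `Γ` is a simple closed curve of class `C^{2,α}`. -/
def IsC2ClosedCurve (α : ℝ) (Γ : Set (ℝ × ℝ)) : Prop :=
  ∃ γ : ℝ → ℝ × ℝ, Function.Periodic γ 1 ∧ C2HolderOn α γ (Icc 0 1) ∧
    InjOn γ (Ico 0 1) ∧ Γ = γ '' Icc 0 1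

/-- The ground state energy `λ^D(Ω)` of the Dirichlet Laplacian on `Ω`. -/
def dirichletGSE (Ω : Set (ℝ × ℝ)) : ℝ :=
  sInf ((fun u : ℝ × ℝ → ℝ =>
      (∫ x in Ω, (pd1 u x ^ 2 + pd2 u x ^ 2)) / ∫ x in Ω, u x ^ 2) ''
    {u | ContDiff ℝ (⊤ : ℕ∞) u ∧ HasCompactSupport u ∧ tsupport u ⊆ Ω ∧ u ≠ 0})

/-- The open disc of radius `R` centred at the origin (with the Euclidean distance). -/
def disc (R : ℝ) : Set (ℝ × ℝ) := {y : ℝ × ℝ | y.1 ^ 2 + y.2 ^ 2 < R ^ 2}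

end

section Calculus

variable {E : Type*} [NormedAddCommGroup E] [NormedSpace ℝ E]

theorem ContDiff.pd1 {u : ℝ × ℝ → E} (hu : ContDiff ℝ (⊤ : ℕ∞) u) :
    ContDiff ℝ (⊤ : ℕ∞) (pd1 u) :=
  (hu.fderiv_right (m := (⊤ : ℕ∞)) (by simp)).clm_apply contDiff_const

theorem ContDiff.pd2 {u : ℝ × ℝ → E} (hu : ContDiff ℝ (⊤ : ℕ∞) u) :
    ContDiff ℝ (⊤ : ℕ∞) (pd2 u) :=
  (hu.fderiv_right (m := (⊤ : ℕ∞)) (by simp)).clm_apply contDiff_const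

theorem HasCompactSupport.pd1 {u : ℝ × ℝ → E} (hu : HasCompactSupport u) :
    HasCompactSupport (pd1 u) := hu.fderiv_apply ℝ (1, 0)

theorem HasCompactSupport.pd2 {u : ℝ × ℝ → E} (hu : HasCompactSupport u) :
    HasCompactSupport (pd2 u) := hu.fderiv_apply ℝ (0, 1)

theorem pd1_eq_zero_of_notMem_tsupport {u : ℝ × ℝ → E} {x : ℝ × ℝ} (hx : x ∉ tsupport u) :
    pd1 u x = 0 := by
  have := image_eq_zero_of_notMem_tsupport (fun h => hx (tsupport_fderiv_subset ℝ h))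
  simp [_root_.pd1, this]

theorem pd2_eq_zero_of_notMem_tsupport {u : ℝ × ℝ → E} {x : ℝ × ℝ} (hx : x ∉ tsupport u) :
    pd2 u x = 0 := by
  have := image_eq_zero_of_notMem_tsupport (fun h => hx (tsupport_fderiv_subset ℝ h))
  simp [_root_.pd2, this]

theorem pd1_pd2_comm {u : ℝ × ℝ → E} (hu : ContDiff ℝ (⊤ : ℕ∞) u) (x : ℝ × ℝ) :
    pd1 (pd2 u) x = pd2 (pd1 u) x := by
  have hd : DifferentiableAt ℝ (fderiv ℝ u) x :=
    ((hu.fderiv_right (m := (⊤ : ℕ∞)) (by simp)).differentiable (by simp)) x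
  have hs : IsSymmSndFDerivAt ℝ u x :=
    hu.contDiffAt.isSymmSndFDerivAt (by
      rw [minSmoothness_of_isRCLikeNormedField]
      exact WithTop.coe_le_coe.2 le_top)
  have h1 := hs (1, 0) (0, 1)
  unfold pd1 pd2
  rw [fderiv_clm_apply hd (differentiableAt_const _),
    fderiv_clm_apply hd (differentiableAt_const _)]
  simpa using h1

theorem integral_fderiv_apply_eq_zero {f : ℝ × ℝ → ℝ} (hf : ContDiff ℝ 1 f)
    (hc : HasCompactSupport f) (v : ℝ × ℝ) : ∫ x, fderiv ℝ f x v = 0 := by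
  have h := integral_mul_fderiv_eq_neg_fderiv_mul_of_integrable (μ := (volume : Measure (ℝ × ℝ)))
    (f := fun _ => (1 : ℝ)) (g := f) (v := v) (by simp)
    (by
      simp only [one_mul]
      exact ((hf.continuous_fderiv (by simp)).clm_apply
        continuous_const).integrable_of_hasCompactSupport (hc.fderiv_apply ℝ v))
    (by simpa using hf.continuous.integrable_of_hasCompactSupport hc)
    (fun x _ => differentiableAt_const _) (fun x _ => hf.differentiable (by simp) x)
  simpa using h

theorem integral_pd1_eq_zero {f : ℝ × ℝ → ℝ} (hf : ContDiff ℝ (⊤ : ℕ∞) f)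
    (hc : HasCompactSupport f) : ∫ x, pd1 f x = 0 :=
  integral_fderiv_apply_eq_zero (hf.of_le (by simp)) hc _

theorem integral_pd2_eq_zero {f : ℝ × ℝ → ℝ} (hf : ContDiff ℝ (⊤ : ℕ∞) f)
    (hc : HasCompactSupport f) : ∫ x, pd2 f x = 0 :=
  integral_fderiv_apply_eq_zero (hf.of_le (by simp)) hc _

theorem fderiv_im_mul_conj {f g : ℝ × ℝ → ℂ} {x : ℝ × ℝ} (hf : DifferentiableAt ℝ f x)
    (hg : DifferentiableAt ℝ g x) (v : ℝ × ℝ) :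
    fderiv ℝ (fun y => (f y * star (g y)).im) x v
      = (fderiv ℝ f x v * star (g x) + f x * star (fderiv ℝ g x v)).im := by
  have h := Complex.imCLM.hasFDerivAt.comp x (hf.hasFDerivAt.mul hg.hasFDerivAt.star)
  have h' : HasFDerivAt (fun y => (f y * star (g y)).im) _ x := h
  rw [h'.fderiv]
  simp
  ring

theorem fderiv_norm_sq_comp_apply {f : ℝ × ℝ → ℂ} {x : ℝ × ℝ} (hf : DifferentiableAt ℝ f x)
    (v : ℝ × ℝ) :
    fderiv ℝ (fun y => ‖f y‖ ^ 2) x v = 2 * (fderiv ℝ f x v * star (f x)).re := by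
  have h' : HasFDerivAt (fun y => ‖f y‖ ^ 2) _ x := hf.hasFDerivAt.norm_sq
  rw [h'.fderiv]
  simp [Complex.inner]
  ring

end Calculus

section MagneticIdentities

/-- The Jacobian density `Im (∂₁u · conj ∂₂u)` of a complex function. -/
noncomputable def jac (u : ℝ × ℝ → ℂ) (x : ℝ × ℝ) : ℝ := (pd1 u x * star (pd2 u x)).im

theorem integral_jac_eq_zero {u : ℝ × ℝ → ℂ} (hu : ContDiff ℝ (⊤ : ℕ∞) u)
    (hc : HasCompactSupport u) : ∫ x, jac u x = 0 := by
  have d0 : Differentiable ℝ u := hu.differentiable (by simp)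
  have d1 : Differentiable ℝ (pd1 u) := hu.pd1.differentiable (by simp)
  have d2 : Differentiable ℝ (pd2 u) := hu.pd2.differentiable (by simp)
  set F : ℝ × ℝ → ℝ := fun y => (u y * star (pd2 u y)).im
  set G : ℝ × ℝ → ℝ := fun y => (u y * star (pd1 u y)).im
  have hF : ContDiff ℝ (⊤ : ℕ∞) F :=
    Complex.imCLM.contDiff.comp (hu.mul ((starL' ℝ : ℂ ≃L[ℝ] ℂ).contDiff.comp hu.pd2))
  have hG : ContDiff ℝ (⊤ : ℕ∞) G :=
    Complex.imCLM.contDiff.comp (hu.mul ((starL' ℝ : ℂ ≃L[ℝ] ℂ).contDiff.comp hu.pd1))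
  have cF : HasCompactSupport F := hc.mono (by
    intro x; contrapose!; intro h; simp only [Function.mem_support, not_not] at h; simp [F, h])
  have cG : HasCompactSupport G := hc.mono (by
    intro x; contrapose!; intro h; simp only [Function.mem_support, not_not] at h; simp [G, h])
  have key : ∀ x, jac u x = (1 / 2) * (pd1 F x - pd2 G x) := by
    intro x
    have e1 : pd1 F x = (pd1 u x * star (pd2 u x) + u x * star (pd1 (pd2 u) x)).im :=
      fderiv_im_mul_conj (d0 x) (d2 x) _
    have e2 : pd2 G x = (pd2 u x * star (pd1 u x) + u x * star (pd2 (pd1 u) x)).im :=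
      fderiv_im_mul_conj (d0 x) (d1 x) _
    rw [e1, e2, pd1_pd2_comm hu, jac]
    simp
    ring
  simp_rw [key]
  rw [integral_const_mul, integral_sub
    (hF.pd1.continuous.integrable_of_hasCompactSupport cF.pd1)
    (hG.pd2.continuous.integrable_of_hasCompactSupport cG.pd2),
    integral_pd1_eq_zero hF cF, integral_pd2_eq_zero hG cG]
  simp

/-- The operator `∂₁ + iτ∂₂`. -/
noncomputable def cr (τ : ℝ) (v : ℝ × ℝ → ℂ) (x : ℝ × ℝ) : ℂ := pd1 v x + Complex.I * τ * pd2 v x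

theorem sq_norm_add_I_mul {τ : ℝ} (hτ : τ ^ 2 = 1) (a b : ℂ) :
    ‖a + Complex.I * τ * b‖ ^ 2 = ‖a‖ ^ 2 + ‖b‖ ^ 2 + 2 * τ * (a * star b).im := by
  simp only [← Complex.normSq_eq_norm_sq, Complex.normSq_apply]
  simp
  linear_combination (b.re ^ 2 + b.im ^ 2) * hτ

theorem continuous_cr {τ : ℝ} {v : ℝ × ℝ → ℂ} (hv : ContDiff ℝ (⊤ : ℕ∞) v) :
    Continuous (cr τ v) := by
  have h1 := hv.pd1.continuous
  have h2 := hv.pd2.continuous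
  unfold cr
  fun_prop

theorem cr_eq_zero_of_notMem_tsupport {τ : ℝ} {v : ℝ × ℝ → ℂ} {x : ℝ × ℝ}
    (hx : x ∉ tsupport v) : cr τ v x = 0 := by
  simp [cr, pd1_eq_zero_of_notMem_tsupport hx, pd2_eq_zero_of_notMem_tsupport hx]

theorem HasCompactSupport.of_tsupport {E F : Type*} [NormedAddCommGroup E] [NormedAddCommGroup F]
    {v : ℝ × ℝ → E} (hv : HasCompactSupport v) {f : ℝ × ℝ → F}
    (hf : ∀ x, x ∉ tsupport v → f x = 0) : HasCompactSupport f :=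
  HasCompactSupport.intro hv hf

theorem integral_sq_norm_cr {τ : ℝ} (hτ : τ ^ 2 = 1) {v : ℝ × ℝ → ℂ}
    (hv : ContDiff ℝ (⊤ : ℕ∞) v) (hc : HasCompactSupport v) :
    ∫ x, ‖cr τ v x‖ ^ 2 = ∫ x, (‖pd1 v x‖ ^ 2 + ‖pd2 v x‖ ^ 2) := by
  have h1 := hv.pd1.continuous
  have h2 := hv.pd2.continuous
  have hj : Integrable (jac v) := by
    refine Continuous.integrable_of_hasCompactSupport (by unfold jac; fun_prop)
      (hc.of_tsupport fun x hx => ?_)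
    simp [jac, pd1_eq_zero_of_notMem_tsupport hx]
  have hi : Integrable (fun x => ‖pd1 v x‖ ^ 2 + ‖pd2 v x‖ ^ 2) := by
    refine Continuous.integrable_of_hasCompactSupport (by fun_prop)
      (hc.of_tsupport fun x hx => ?_)
    simp [pd1_eq_zero_of_notMem_tsupport hx, pd2_eq_zero_of_notMem_tsupport hx]
  have key : ∀ x, ‖cr τ v x‖ ^ 2 = (‖pd1 v x‖ ^ 2 + ‖pd2 v x‖ ^ 2) + (2 * τ) * jac v x :=
    fun x => sq_norm_add_I_mul hτ _ _
  simp_rw [key]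
  rw [integral_add hi (hj.const_mul _), integral_const_mul, integral_jac_eq_zero hv hc]
  simp

/-- Poincaré inequality for functions supported in the strip `|x₁| ≤ 1`. -/
theorem poincare_strip {v : ℝ × ℝ → ℂ} (hv : ContDiff ℝ (⊤ : ℕ∞) v) (hc : HasCompactSupport v)
    (hs : ∀ x ∈ tsupport v, x.1 ^ 2 ≤ 1) :
    ∫ x, ‖v x‖ ^ 2 ≤ 4 * ∫ x, (‖pd1 v x‖ ^ 2 + ‖pd2 v x‖ ^ 2) := by
  have h0 := hv.continuous
  have h1 := hv.pd1.continuous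
  have h2 := hv.pd2.continuous
  have d0 : Differentiable ℝ v := hv.differentiable (by simp)
  set F : ℝ × ℝ → ℝ := fun y => y.1 * ‖v y‖ ^ 2
  have hF : ContDiff ℝ (⊤ : ℕ∞) F := contDiff_fst.mul (hv.norm_sq ℝ)
  have cF : HasCompactSupport F := hc.of_tsupport fun x hx => by
    simp [F, image_eq_zero_of_notMem_tsupport hx]
  have i0 : Integrable (fun x => ‖v x‖ ^ 2) := by
    refine Continuous.integrable_of_hasCompactSupport (by fun_prop)
      (hc.of_tsupport fun x hx => ?_)
    simp [image_eq_zero_of_notMem_tsupport hx]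
  have i1 : Integrable (fun x => ‖pd1 v x‖ ^ 2 + ‖pd2 v x‖ ^ 2) := by
    refine Continuous.integrable_of_hasCompactSupport (by fun_prop)
      (hc.of_tsupport fun x hx => ?_)
    simp [pd1_eq_zero_of_notMem_tsupport hx, pd2_eq_zero_of_notMem_tsupport hx]
  have iF : Integrable (pd1 F) := hF.pd1.continuous.integrable_of_hasCompactSupport cF.pd1
  have hder : ∀ x, pd1 F x = ‖v x‖ ^ 2 + x.1 * (2 * (pd1 v x * star (v x)).re) := by
    intro x
    have hn : DifferentiableAt ℝ (fun y => ‖v y‖ ^ 2) x := (d0 x).norm_sq ℝ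
    have h := (hasFDerivAt_fst (𝕜 := ℝ) (p := x)).mul hn.hasFDerivAt
    have h' : HasFDerivAt F _ x := h
    have e := fderiv_norm_sq_comp_apply (d0 x) (1, 0)
    simp only [pd1]
    rw [h'.fderiv]
    simp [e]
    ring
  have pt : ∀ x, (1 / 2) * ‖v x‖ ^ 2 - 2 * (‖pd1 v x‖ ^ 2 + ‖pd2 v x‖ ^ 2) ≤ pd1 F x := by
    intro x
    by_cases hx : x ∈ tsupport v
    · rw [hder]
      have ha : |(pd1 v x * star (v x)).re| ≤ ‖pd1 v x‖ * ‖v x‖ := by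
        simpa using Complex.abs_re_le_norm (pd1 v x * star (v x))
      have hb : |x.1| ≤ 1 := by
        have := hs x hx
        exact abs_le_one_iff_mul_self_le_one.2 (by nlinarith)
      have hab : |x.1 * (pd1 v x * star (v x)).re| ≤ ‖pd1 v x‖ * ‖v x‖ := by
        rw [abs_mul]
        nlinarith [abs_nonneg x.1, abs_nonneg (pd1 v x * star (v x)).re]
      have := neg_abs_le (x.1 * (pd1 v x * star (v x)).re)
      nlinarith [sq_nonneg (‖v x‖ - 2 * ‖pd1 v x‖), sq_nonneg (‖pd2 v x‖)]
    · have : x ∉ tsupport F := fun h => hx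
        (closure_mono (fun y hy => by
          contrapose! hy; simp only [Function.mem_support, not_not] at hy; simp [F, hy]) h)
      simp [pd1_eq_zero_of_notMem_tsupport hx, pd2_eq_zero_of_notMem_tsupport hx,
        image_eq_zero_of_notMem_tsupport hx, pd1_eq_zero_of_notMem_tsupport this]
  have := integral_mono ((i0.const_mul (1 / 2)).sub (i1.const_mul 2)) iF pt
  rw [integral_pd1_eq_zero hF cF, integral_sub' (i0.const_mul (1 / 2)) (i1.const_mul 2),
    integral_const_mul, integral_const_mul] at this
  linarith

/-- The magnetic derivative `h∂₁ - iA₁` for `A = ∇⊥ψ`. -/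
noncomputable def mag1 (h : ℝ) (ψ : ℝ × ℝ → ℝ) (u : ℝ × ℝ → ℂ) (x : ℝ × ℝ) : ℂ :=
  (h : ℂ) * pd1 u x - Complex.I * ((perpGrad ψ x).1 : ℂ) * u x

/-- The magnetic derivative `h∂₂ - iA₂` for `A = ∇⊥ψ`. -/
noncomputable def mag2 (h : ℝ) (ψ : ℝ × ℝ → ℝ) (u : ℝ × ℝ → ℂ) (x : ℝ × ℝ) : ℂ :=
  (h : ℂ) * pd2 u x - Complex.I * ((perpGrad ψ x).2 : ℂ) * u x

theorem continuous_mag1 (h : ℝ) {ψ : ℝ × ℝ → ℝ} (hψ : ContDiff ℝ (⊤ : ℕ∞) ψ)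
    {u : ℝ × ℝ → ℂ} (hu : ContDiff ℝ (⊤ : ℕ∞) u) : Continuous (mag1 h ψ u) := by
  have h0 := hu.continuous
  have h1 := hu.pd1.continuous
  have h2 := hψ.pd2.continuous
  unfold mag1 perpGrad
  fun_prop

theorem continuous_mag2 (h : ℝ) {ψ : ℝ × ℝ → ℝ} (hψ : ContDiff ℝ (⊤ : ℕ∞) ψ)
    {u : ℝ × ℝ → ℂ} (hu : ContDiff ℝ (⊤ : ℕ∞) u) : Continuous (mag2 h ψ u) := by
  have h0 := hu.continuous
  have h1 := hu.pd2.continuous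
  have h2 := hψ.pd1.continuous
  unfold mag2 perpGrad
  fun_prop

theorem mag1_eq_zero_of_notMem_tsupport {h : ℝ} {ψ : ℝ × ℝ → ℝ} {u : ℝ × ℝ → ℂ} {x : ℝ × ℝ}
    (hx : x ∉ tsupport u) : mag1 h ψ u x = 0 := by
  simp [mag1, pd1_eq_zero_of_notMem_tsupport hx, image_eq_zero_of_notMem_tsupport hx]

theorem mag2_eq_zero_of_notMem_tsupport {h : ℝ} {ψ : ℝ × ℝ → ℝ} {u : ℝ × ℝ → ℂ} {x : ℝ × ℝ}
    (hx : x ∉ tsupport u) : mag2 h ψ u x = 0 := by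
  simp [mag2, pd2_eq_zero_of_notMem_tsupport hx, image_eq_zero_of_notMem_tsupport hx]

theorem continuous_lap {ψ : ℝ × ℝ → ℝ} (hψ : ContDiff ℝ (⊤ : ℕ∞) ψ) : Continuous (lap ψ) :=
  hψ.pd1.pd1.continuous.add hψ.pd2.pd2.continuous

theorem pauli_pointwise {τ h : ℝ} (hτ : τ ^ 2 = 1) {ψ : ℝ × ℝ → ℝ} (hψ : ContDiff ℝ (⊤ : ℕ∞) ψ)
    {u : ℝ × ℝ → ℂ} (hu : ContDiff ℝ (⊤ : ℕ∞) u) (x : ℝ × ℝ) :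
    ‖mag1 h ψ u x‖ ^ 2 + ‖mag2 h ψ u x‖ ^ 2 =
      ‖mag1 h ψ u x + Complex.I * τ * mag2 h ψ u x‖ ^ 2
      + τ * h * (lap ψ x * ‖u x‖ ^ 2) - 2 * τ * h ^ 2 * jac u x
      - τ * h * (pd1 (fun y => pd1 ψ y * ‖u y‖ ^ 2) x + pd2 (fun y => pd2 ψ y * ‖u y‖ ^ 2) x) := by
  have d0 : DifferentiableAt ℝ u x := hu.differentiable (by simp) x
  have dn : DifferentiableAt ℝ (fun y => ‖u y‖ ^ 2) x := d0.norm_sq ℝ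
  have d1 : DifferentiableAt ℝ (pd1 ψ) x := hψ.pd1.differentiable (by simp) x
  have d2 : DifferentiableAt ℝ (pd2 ψ) x := hψ.pd2.differentiable (by simp) x
  have e1 : pd1 (fun y => pd1 ψ y * ‖u y‖ ^ 2) x
      = pd1 (pd1 ψ) x * ‖u x‖ ^ 2 + pd1 ψ x * (2 * (pd1 u x * star (u x)).re) := by
    have e := fderiv_norm_sq_comp_apply d0 (1, 0)
    have h' : HasFDerivAt (fun y => pd1 ψ y * ‖u y‖ ^ 2) _ x := d1.hasFDerivAt.mul dn.hasFDerivAt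
    rw [pd1, h'.fderiv]
    simp only [add_apply, smul_apply, smul_eq_mul, e]
    simp only [pd1]
    ring
  have e2 : pd2 (fun y => pd2 ψ y * ‖u y‖ ^ 2) x
      = pd2 (pd2 ψ) x * ‖u x‖ ^ 2 + pd2 ψ x * (2 * (pd2 u x * star (u x)).re) := by
    have e := fderiv_norm_sq_comp_apply d0 (0, 1)
    have h' : HasFDerivAt (fun y => pd2 ψ y * ‖u y‖ ^ 2) _ x := d2.hasFDerivAt.mul dn.hasFDerivAt
    rw [pd2, h'.fderiv]
    simp only [add_apply, smul_apply, smul_eq_mul, e]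
    simp only [pd2]
    ring
  rw [sq_norm_add_I_mul hτ, e1, e2, lap, jac]
  simp only [mag1, mag2, perpGrad]
  simp
  ring

theorem pauli_form_eq {τ h : ℝ} (hτ : τ ^ 2 = 1) {ψ : ℝ × ℝ → ℝ} (hψ : ContDiff ℝ (⊤ : ℕ∞) ψ)
    {u : ℝ × ℝ → ℂ} (hu : ContDiff ℝ (⊤ : ℕ∞) u) (hc : HasCompactSupport u) :
    (∫ x, (‖mag1 h ψ u x‖ ^ 2 + ‖mag2 h ψ u x‖ ^ 2)) + -τ * (h * ∫ x, lap ψ x * ‖u x‖ ^ 2)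
      = ∫ x, ‖mag1 h ψ u x + Complex.I * τ * mag2 h ψ u x‖ ^ 2 := by
  have c0 := hu.continuous
  have c1 := hu.pd1.continuous
  have c2 := hu.pd2.continuous
  have cm1 := continuous_mag1 h hψ hu
  have cm2 := continuous_mag2 h hψ hu
  have cl := continuous_lap hψ
  have iM : Integrable (fun x => ‖mag1 h ψ u x + Complex.I * τ * mag2 h ψ u x‖ ^ 2) := by
    refine Continuous.integrable_of_hasCompactSupport (by fun_prop)
      (hc.of_tsupport fun x hx => ?_)
    simp [mag1_eq_zero_of_notMem_tsupport hx, mag2_eq_zero_of_notMem_tsupport hx]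
  have iL : Integrable (fun x => lap ψ x * ‖u x‖ ^ 2) := by
    refine Continuous.integrable_of_hasCompactSupport (by fun_prop)
      (hc.of_tsupport fun x hx => ?_)
    simp [image_eq_zero_of_notMem_tsupport hx]
  have iJ : Integrable (jac u) := by
    refine Continuous.integrable_of_hasCompactSupport (by unfold jac; fun_prop)
      (hc.of_tsupport fun x hx => ?_)
    simp [jac, pd1_eq_zero_of_notMem_tsupport hx]
  have s1 : ContDiff ℝ (⊤ : ℕ∞) (fun y => pd1 ψ y * ‖u y‖ ^ 2) := hψ.pd1.mul (hu.norm_sq ℝ)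
  have s2 : ContDiff ℝ (⊤ : ℕ∞) (fun y => pd2 ψ y * ‖u y‖ ^ 2) := hψ.pd2.mul (hu.norm_sq ℝ)
  have k1 : HasCompactSupport (fun y => pd1 ψ y * ‖u y‖ ^ 2) :=
    hc.of_tsupport fun x hx => by simp [image_eq_zero_of_notMem_tsupport hx]
  have k2 : HasCompactSupport (fun y => pd2 ψ y * ‖u y‖ ^ 2) :=
    hc.of_tsupport fun x hx => by simp [image_eq_zero_of_notMem_tsupport hx]
  have i1 := s1.pd1.continuous.integrable_of_hasCompactSupport (μ := volume) k1.pd1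
  have i2 := s2.pd2.continuous.integrable_of_hasCompactSupport (μ := volume) k2.pd2
  have iA : Integrable (fun x => ‖mag1 h ψ u x + Complex.I * τ * mag2 h ψ u x‖ ^ 2
      + τ * h * (lap ψ x * ‖u x‖ ^ 2)) := iM.add (iL.const_mul _)
  have iB : Integrable (fun x => ‖mag1 h ψ u x + Complex.I * τ * mag2 h ψ u x‖ ^ 2
      + τ * h * (lap ψ x * ‖u x‖ ^ 2) - 2 * τ * h ^ 2 * jac u x) := iA.sub (iJ.const_mul _)
  have i12 : Integrable (fun x => pd1 (fun y => pd1 ψ y * ‖u y‖ ^ 2) x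
      + pd2 (fun y => pd2 ψ y * ‖u y‖ ^ 2) x) := i1.add i2
  have step : ∫ x, (‖mag1 h ψ u x‖ ^ 2 + ‖mag2 h ψ u x‖ ^ 2)
      = (∫ x, ‖mag1 h ψ u x + Complex.I * τ * mag2 h ψ u x‖ ^ 2)
        + τ * h * (∫ x, lap ψ x * ‖u x‖ ^ 2) - 2 * τ * h ^ 2 * (∫ x, jac u x)
        - τ * h * ((∫ x, pd1 (fun y => pd1 ψ y * ‖u y‖ ^ 2) x)
          + ∫ x, pd2 (fun y => pd2 ψ y * ‖u y‖ ^ 2) x) := by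
    rw [← integral_add i1 i2, ← integral_const_mul, ← integral_const_mul, ← integral_const_mul,
      ← integral_add iM (iL.const_mul _),
      ← integral_sub iA (iJ.const_mul _),
      ← integral_sub iB (i12.const_mul _)]
    exact integral_congr_ae (Eventually.of_forall (pauli_pointwise hτ hψ hu))
  rw [step, integral_pd1_eq_zero s1 k1, integral_pd2_eq_zero s2 k2, integral_jac_eq_zero hu hc]
  ring

/-- The factor `exp (-φ/h)` applied to `v`. -/
noncomputable def expTwist (h : ℝ) (φ : ℝ × ℝ → ℝ) (v : ℝ × ℝ → ℂ) (x : ℝ × ℝ) : ℂ :=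
  Real.exp (-(φ x / h)) • v x

theorem contDiff_expTwist (h : ℝ) {φ : ℝ × ℝ → ℝ} (hφ : ContDiff ℝ (⊤ : ℕ∞) φ) {v : ℝ × ℝ → ℂ}
    (hv : ContDiff ℝ (⊤ : ℕ∞) v) : ContDiff ℝ (⊤ : ℕ∞) (expTwist h φ v) :=
  ((hφ.div_const h).neg.exp).smul hv

theorem support_expTwist (h : ℝ) (φ : ℝ × ℝ → ℝ) (v : ℝ × ℝ → ℂ) :
    Function.support (expTwist h φ v) = Function.support v := by
  ext x
  simp [expTwist]

theorem tsupport_expTwist (h : ℝ) (φ : ℝ × ℝ → ℝ) (v : ℝ × ℝ → ℂ) :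
    tsupport (expTwist h φ v) = tsupport v := by
  simp [tsupport, support_expTwist]

theorem expTwist_expTwist_neg (h : ℝ) (φ : ℝ × ℝ → ℝ) (v : ℝ × ℝ → ℂ) :
    expTwist h φ (expTwist h (fun x => -φ x) v) = v := by
  ext1 x
  simp only [expTwist, smul_smul, ← Real.exp_add]
  simp [neg_div]

theorem IsTestFun.expTwist {Ω : Set (ℝ × ℝ)} (h : ℝ) {φ : ℝ × ℝ → ℝ}
    (hφ : ContDiff ℝ (⊤ : ℕ∞) φ) {v : ℝ × ℝ → ℂ} (hv : IsTestFun Ω v) :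
    IsTestFun Ω (expTwist h φ v) := by
  obtain ⟨h1, h2, h3, h4⟩ := hv
  refine ⟨contDiff_expTwist h hφ h1, ?_, by rwa [tsupport_expTwist], ?_⟩
  · rwa [HasCompactSupport, tsupport_expTwist]
  · rw [← Function.support_nonempty_iff] at h4 ⊢
    rwa [support_expTwist]

theorem sq_norm_expTwist (h : ℝ) (φ : ℝ × ℝ → ℝ) (v : ℝ × ℝ → ℂ) (x : ℝ × ℝ) :
    ‖expTwist h φ v x‖ ^ 2 = Real.exp (-2 * φ x / h) * ‖v x‖ ^ 2 := by
  rw [expTwist, norm_smul, mul_pow, Real.norm_of_nonneg (Real.exp_pos _).le, ← Real.exp_nat_mul]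
  congr 2
  push_cast
  ring

theorem mag_expTwist {τ h : ℝ} (hτ : τ ^ 2 = 1) (hh : 0 < h) {ψ : ℝ × ℝ → ℝ}
    (hψ : ContDiff ℝ (⊤ : ℕ∞) ψ) {v : ℝ × ℝ → ℂ} (hv : ContDiff ℝ (⊤ : ℕ∞) v) (x : ℝ × ℝ) :
    mag1 h ψ (expTwist h (fun y => τ * ψ y) v) x
      + Complex.I * τ * mag2 h ψ (expTwist h (fun y => τ * ψ y) v) x
      = h * expTwist h (fun y => τ * ψ y) (cr τ v) x := by
  have dv : DifferentiableAt ℝ v x := hv.differentiable (by simp) x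
  have dψ : DifferentiableAt ℝ ψ x := hψ.differentiable (by simp) x
  have hE : HasFDerivAt (fun y => Real.exp (-(τ * ψ y / h))) _ x :=
    (((dψ.hasFDerivAt.const_mul τ).mul_const h⁻¹).neg).exp
  have hF : HasFDerivAt (expTwist h (fun y => τ * ψ y) v) _ x := hE.smul dv.hasFDerivAt
  have hhc : (h : ℂ) ≠ 0 := by exact_mod_cast hh.ne'
  have hτc : (τ : ℂ) ^ 2 = 1 := by exact_mod_cast hτ
  have hI : Complex.I ^ 2 = -1 := Complex.I_sq
  simp only [mag1, mag2, perpGrad]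
  have e1 : pd1 (expTwist h (fun y => τ * ψ y) v) x = (Real.exp (-(τ * ψ x / h)) : ℂ) *
      (pd1 v x - τ * h⁻¹ * pd1 ψ x * v x) := by
    rw [pd1, hF.fderiv]
    simp [pd1, div_eq_mul_inv]
    ring
  have e2 : pd2 (expTwist h (fun y => τ * ψ y) v) x = (Real.exp (-(τ * ψ x / h)) : ℂ) *
      (pd2 v x - τ * h⁻¹ * pd2 ψ x * v x) := by
    rw [pd2, hF.fderiv]
    simp [pd2, div_eq_mul_inv]
    ring
  rw [e1, e2]
  simp only [expTwist, cr, Complex.real_smul]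
  generalize (Real.exp (-(τ * ψ x / h)) : ℂ) = E
  push_cast
  field_simp
  linear_combination (-E * v x * ((pd2 ψ x : ℝ) : ℂ) * Complex.I) * hτc
    - (E * v x * ((pd1 ψ x : ℝ) : ℂ) * τ) * hI

theorem setIntegral_eq_integral_of_tsupport {Ω : Set (ℝ × ℝ)} {u : ℝ × ℝ → ℂ}
    (hu : tsupport u ⊆ Ω) {f : ℝ × ℝ → ℝ} (hf : ∀ x, x ∉ tsupport u → f x = 0) :
    ∫ x in Ω, f x = ∫ x, f x :=
  setIntegral_eq_integral_of_forall_compl_eq_zero fun x hx => hf x fun h => hx (hu h)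

/-- The Rayleigh quotient in terms of the twisted function. -/
theorem pauliRayleigh_expTwist {τ h : ℝ} (hτ : τ ^ 2 = 1) (hh : 0 < h) {ψ : ℝ × ℝ → ℝ}
    (hψ : ContDiff ℝ (⊤ : ℕ∞) ψ) {Ω : Set (ℝ × ℝ)} {v : ℝ × ℝ → ℂ} (hv : IsTestFun Ω v) :
    pauliRayleigh (-τ) h (perpGrad ψ) (lap ψ) Ω (expTwist h (fun y => τ * ψ y) v)
      = h ^ 2 * (∫ x, Real.exp (-2 * (τ * ψ x) / h) * ‖cr τ v x‖ ^ 2)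
        / ∫ x, Real.exp (-2 * (τ * ψ x) / h) * ‖v x‖ ^ 2 := by
  have hφ : ContDiff ℝ (⊤ : ℕ∞) (fun y => τ * ψ y) := contDiff_const.mul hψ
  have hu := hv.expTwist h hφ
  set u := _root_.expTwist h (fun y => τ * ψ y) v with hudef
  have e1 := setIntegral_eq_integral_of_tsupport hu.2.2.1
    (f := fun x => ‖mag1 h ψ u x‖ ^ 2 + ‖mag2 h ψ u x‖ ^ 2) (fun x hx => by
      simp [mag1_eq_zero_of_notMem_tsupport hx, mag2_eq_zero_of_notMem_tsupport hx])
  have e2 := setIntegral_eq_integral_of_tsupport hu.2.2.1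
    (f := fun x => lap ψ x * ‖u x‖ ^ 2) (fun x hx => by
      simp [image_eq_zero_of_notMem_tsupport hx])
  have e3 := setIntegral_eq_integral_of_tsupport hu.2.2.1
    (f := fun x => ‖u x‖ ^ 2) (fun x hx => by simp [image_eq_zero_of_notMem_tsupport hx])
  simp only [mag1, mag2] at e1
  rw [pauliRayleigh, e1, e2, e3]
  have e4 := pauli_form_eq (h := h) hτ hψ hu.1 hu.2.1
  simp only [mag1, mag2] at e4
  rw [e4]
  congr 1
  · rw [← integral_const_mul]
    congr 1
    ext1 x
    have := mag_expTwist hτ hh hψ hv.1 x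
    simp only [mag1, mag2] at this
    rw [hudef, this, norm_mul, mul_pow, sq_norm_expTwist]
    simp
  · simp_rw [hudef, sq_norm_expTwist]

end MagneticIdentities

section RayleighBounds

theorem integral_exp_mul_sq_norm_pos {Ω : Set (ℝ × ℝ)} {g : ℝ × ℝ → ℝ} (hg : Continuous g)
    {v : ℝ × ℝ → ℂ} (hv : IsTestFun Ω v) : 0 < ∫ x, Real.exp (g x) * ‖v x‖ ^ 2 := by
  obtain ⟨x₀, hx₀⟩ := Function.ne_iff.1 hv.2.2.2
  have c := hv.1.continuous
  refine Continuous.integral_pos_of_hasCompactSupport_nonneg_nonzero (x := x₀) (by fun_prop)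
    (hv.2.1.of_tsupport fun x hx => by simp [image_eq_zero_of_notMem_tsupport hx])
    (fun x => by positivity) ?_
  simpa using hx₀

theorem exp_two_mul_div_le {h s t : ℝ} (hh : 0 < h) (hst : s ≤ t) :
    Real.exp (-2 * t / h) ≤ Real.exp (-2 * s / h) := by
  refine Real.exp_le_exp.2 (div_le_div_of_nonneg_right ?_ hh.le)
  linarith

theorem exp_sub_div (h s t : ℝ) :
    Real.exp (-2 * (t - s) / h) * Real.exp (-2 * s / h) = Real.exp (-2 * t / h) := by
  rw [← Real.exp_add]
  congr 1
  ring

theorem le_pauliRayleigh {τ h m M : ℝ} (hτ : τ ^ 2 = 1) (hh : 0 < h) {ψ : ℝ × ℝ → ℝ}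
    (hψ : ContDiff ℝ (⊤ : ℕ∞) ψ) {Ω : Set (ℝ × ℝ)} (hΩ : ∀ x ∈ Ω, x.1 ^ 2 ≤ 1)
    (hm : ∀ x ∈ Ω, m ≤ τ * ψ x) (hM : ∀ x ∈ Ω, τ * ψ x ≤ M) {u : ℝ × ℝ → ℂ}
    (hu : IsTestFun Ω u) :
    h ^ 2 / 4 * Real.exp (-2 * (M - m) / h) ≤ pauliRayleigh (-τ) h (perpGrad ψ) (lap ψ) Ω u := by
  have hφ : ContDiff ℝ (⊤ : ℕ∞) (fun y => τ * ψ y) := contDiff_const.mul hψ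
  have cψ := hψ.continuous
  have hv := hu.expTwist h hφ.neg
  rw [← expTwist_expTwist_neg h (fun y => τ * ψ y) u]
  set v := expTwist h (fun y => -(τ * ψ y)) u
  have hv' : IsTestFun Ω v := hv
  rw [pauliRayleigh_expTwist hτ hh hψ hv',
    le_div_iff₀ (integral_exp_mul_sq_norm_pos (by fun_prop) hv')]
  have cv := hv'.1.continuous
  have ccr := continuous_cr (τ := τ) hv'.1
  have iv : Integrable (fun x => ‖v x‖ ^ 2) :=
    Continuous.integrable_of_hasCompactSupport (by fun_prop)
      (hv'.2.1.of_tsupport fun x hx => by simp [image_eq_zero_of_notMem_tsupport hx])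
  have iev : Integrable (fun x => Real.exp (-2 * (τ * ψ x) / h) * ‖v x‖ ^ 2) :=
    Continuous.integrable_of_hasCompactSupport (by fun_prop)
      (hv'.2.1.of_tsupport fun x hx => by simp [image_eq_zero_of_notMem_tsupport hx])
  have ic : Integrable (fun x => ‖cr τ v x‖ ^ 2) :=
    Continuous.integrable_of_hasCompactSupport (by fun_prop)
      (hv'.2.1.of_tsupport fun x hx => by simp [cr_eq_zero_of_notMem_tsupport hx])
  have iec : Integrable (fun x => Real.exp (-2 * (τ * ψ x) / h) * ‖cr τ v x‖ ^ 2) :=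
    Continuous.integrable_of_hasCompactSupport (by fun_prop)
      (hv'.2.1.of_tsupport fun x hx => by simp [cr_eq_zero_of_notMem_tsupport hx])
  have hnum : Real.exp (-2 * M / h) * ∫ x, ‖cr τ v x‖ ^ 2
      ≤ ∫ x, Real.exp (-2 * (τ * ψ x) / h) * ‖cr τ v x‖ ^ 2 := by
    rw [← integral_const_mul]
    refine integral_mono (ic.const_mul _) iec fun x => ?_
    by_cases hx : x ∈ tsupport v
    · exact mul_le_mul_of_nonneg_right (exp_two_mul_div_le hh (hM x (hv'.2.2.1 hx)))
        (by positivity)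
    · simp [cr_eq_zero_of_notMem_tsupport hx]
  have hden : ∫ x, Real.exp (-2 * (τ * ψ x) / h) * ‖v x‖ ^ 2
      ≤ Real.exp (-2 * m / h) * ∫ x, ‖v x‖ ^ 2 := by
    rw [← integral_const_mul]
    refine integral_mono iev (iv.const_mul _) fun x => ?_
    by_cases hx : x ∈ tsupport v
    · exact mul_le_mul_of_nonneg_right (exp_two_mul_div_le hh (hm x (hv'.2.2.1 hx)))
        (by positivity)
    · simp [image_eq_zero_of_notMem_tsupport hx]
  have hP := poincare_strip hv'.1 hv'.2.1 fun x hx => hΩ x (hv'.2.2.1 hx)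
  rw [← integral_sq_norm_cr hτ hv'.1 hv'.2.1] at hP
  calc h ^ 2 / 4 * Real.exp (-2 * (M - m) / h) * ∫ x, Real.exp (-2 * (τ * ψ x) / h) * ‖v x‖ ^ 2
      ≤ h ^ 2 / 4 * Real.exp (-2 * (M - m) / h) * (Real.exp (-2 * m / h) * ∫ x, ‖v x‖ ^ 2) := by
        gcongr
    _ = h ^ 2 / 4 * (Real.exp (-2 * M / h) * ∫ x, ‖v x‖ ^ 2) := by
        rw [← exp_sub_div h m M]; ring
    _ ≤ h ^ 2 / 4 * (Real.exp (-2 * M / h) * (4 * ∫ x, ‖cr τ v x‖ ^ 2)) := by gcongr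
    _ = h ^ 2 * (Real.exp (-2 * M / h) * ∫ x, ‖cr τ v x‖ ^ 2) := by ring
    _ ≤ _ := by gcongr

theorem pauliRayleigh_expTwist_le {τ h a b : ℝ} (hτ : τ ^ 2 = 1) (hh : 0 < h) {ψ : ℝ × ℝ → ℝ}
    (hψ : ContDiff ℝ (⊤ : ℕ∞) ψ) {Ω U : Set (ℝ × ℝ)} {v : ℝ × ℝ → ℂ} (hv : IsTestFun Ω v)
    (hU : MeasurableSet U) (hU0 : 0 < volume.real U) (hv1 : ∀ x ∈ U, v x = 1)
    (hb : ∀ x ∈ U, τ * ψ x ≤ b) (ha : ∀ x, cr τ v x ≠ 0 → a ≤ τ * ψ x) :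
    pauliRayleigh (-τ) h (perpGrad ψ) (lap ψ) Ω (expTwist h (fun y => τ * ψ y) v)
      ≤ (∫ x, ‖cr τ v x‖ ^ 2) / volume.real U * h ^ 2 * Real.exp (-2 * (a - b) / h) := by
  have cψ := hψ.continuous
  have hpos := integral_exp_mul_sq_norm_pos
    (g := fun x => -2 * (τ * ψ x) / h) (by fun_prop) hv
  rw [pauliRayleigh_expTwist hτ hh hψ hv, div_le_iff₀ hpos]
  have cv := hv.1.continuous
  have ccr := continuous_cr (τ := τ) hv.1
  have iev : Integrable (fun x => Real.exp (-2 * (τ * ψ x) / h) * ‖v x‖ ^ 2) :=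
    Continuous.integrable_of_hasCompactSupport (by fun_prop)
      (hv.2.1.of_tsupport fun x hx => by simp [image_eq_zero_of_notMem_tsupport hx])
  have ic : Integrable (fun x => ‖cr τ v x‖ ^ 2) :=
    Continuous.integrable_of_hasCompactSupport (by fun_prop)
      (hv.2.1.of_tsupport fun x hx => by simp [cr_eq_zero_of_notMem_tsupport hx])
  have iec : Integrable (fun x => Real.exp (-2 * (τ * ψ x) / h) * ‖cr τ v x‖ ^ 2) :=
    Continuous.integrable_of_hasCompactSupport (by fun_prop)
      (hv.2.1.of_tsupport fun x hx => by simp [cr_eq_zero_of_notMem_tsupport hx])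
  have hnum : ∫ x, Real.exp (-2 * (τ * ψ x) / h) * ‖cr τ v x‖ ^ 2
      ≤ Real.exp (-2 * a / h) * ∫ x, ‖cr τ v x‖ ^ 2 := by
    rw [← integral_const_mul]
    refine integral_mono iec (ic.const_mul _) fun x => ?_
    by_cases hx : cr τ v x = 0
    · simp [hx]
    · exact mul_le_mul_of_nonneg_right (exp_two_mul_div_le hh (ha x hx)) (by positivity)
  have hfin : volume U ≠ ⊤ := fun h => by simp [Measure.real, h] at hU0
  have hden : volume.real U * Real.exp (-2 * b / h)
      ≤ ∫ x, Real.exp (-2 * (τ * ψ x) / h) * ‖v x‖ ^ 2 := by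
    calc volume.real U * Real.exp (-2 * b / h) = ∫ x in U, Real.exp (-2 * b / h) := by
          rw [setIntegral_const, smul_eq_mul]
      _ ≤ ∫ x in U, Real.exp (-2 * (τ * ψ x) / h) * ‖v x‖ ^ 2 := by
          refine setIntegral_mono_on (integrableOn_const hfin) iev.integrableOn hU fun x hx => ?_
          rw [hv1 x hx]
          simpa using exp_two_mul_div_le hh (hb x hx)
      _ ≤ _ := setIntegral_le_integral iev (Eventually.of_forall fun x => by positivity)
  have hI : 0 ≤ ∫ x, ‖cr τ v x‖ ^ 2 := integral_nonneg fun x => by positivity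
  calc h ^ 2 * ∫ x, Real.exp (-2 * (τ * ψ x) / h) * ‖cr τ v x‖ ^ 2
      ≤ h ^ 2 * (Real.exp (-2 * a / h) * ∫ x, ‖cr τ v x‖ ^ 2) := by gcongr
    _ = (∫ x, ‖cr τ v x‖ ^ 2) / volume.real U * h ^ 2 * Real.exp (-2 * (a - b) / h)
          * (volume.real U * Real.exp (-2 * b / h)) := by
        rw [← exp_sub_div h b a]; field_simp
    _ ≤ _ := by gcongr

end RayleighBounds

section Radial

theorem norm_le_one_of_sq_le {x : ℝ × ℝ} (hx : x.1 ^ 2 + x.2 ^ 2 ≤ 1) : ‖x‖ ≤ 1 := by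
  rw [Prod.norm_def, max_le_iff, Real.norm_eq_abs, Real.norm_eq_abs]
  exact ⟨abs_le_one_iff_mul_self_le_one.2 (by nlinarith [sq_nonneg x.2]),
    abs_le_one_iff_mul_self_le_one.2 (by nlinarith [sq_nonneg x.1])⟩

theorem exists_radial_cutoff {a b : ℝ} (ha : 0 < a) (hab : a < b) (hb : b < 1) :
    ∃ v : ℝ × ℝ → ℂ, IsTestFun (disc 1) v ∧ (∀ x : ℝ × ℝ, x.1 ^ 2 + x.2 ^ 2 < a → v x = 1) ∧
      ∀ τ x, cr τ v x ≠ 0 → a ≤ x.1 ^ 2 + x.2 ^ 2 ∧ x.1 ^ 2 + x.2 ^ 2 ≤ b := by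
  set v : ℝ × ℝ → ℂ := fun x =>
    ((Real.smoothTransition ((b - (x.1 ^ 2 + x.2 ^ 2)) / (b - a)) : ℝ) : ℂ) with hv
  have hba : 0 < b - a := sub_pos.2 hab
  have hone : ∀ x : ℝ × ℝ, x.1 ^ 2 + x.2 ^ 2 < a → v x = 1 := fun x hx => by
    simp only [hv]
    rw [Real.smoothTransition.one_of_one_le ((one_le_div hba).2 (by linarith))]
    simp
  have hzero : ∀ x : ℝ × ℝ, b ≤ x.1 ^ 2 + x.2 ^ 2 → v x = 0 := fun x hx => by
    simp only [hv]
    rw [Real.smoothTransition.zero_of_nonpos (div_nonpos_of_nonpos_of_nonneg (by linarith) hba.le)]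
    simp
  have hts : ∀ x ∈ tsupport v, x.1 ^ 2 + x.2 ^ 2 ≤ b := by
    have hcl : IsClosed {x : ℝ × ℝ | x.1 ^ 2 + x.2 ^ 2 ≤ b} :=
      isClosed_le (by fun_prop) continuous_const
    exact fun x hx => closure_minimal (fun y hy => by
      by_contra h
      exact hy (hzero y (not_le.1 h).le)) hcl hx
  refine ⟨v, ⟨?_, ?_, ?_, ?_⟩, hone, fun τ x hx => ⟨?_, ?_⟩⟩
  · have h1 : ContDiff ℝ (⊤ : ℕ∞) (fun x : ℝ × ℝ => (b - (x.1 ^ 2 + x.2 ^ 2)) / (b - a)) :=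
      (contDiff_const.sub ((contDiff_fst.pow 2).add (contDiff_snd.pow 2))).div_const _
    exact Complex.ofRealCLM.contDiff.comp (Real.smoothTransition.contDiff.comp h1)
  · refine HasCompactSupport.intro (isCompact_closedBall (0 : ℝ × ℝ) 1) fun x hx => hzero x ?_
    by_contra h
    exact hx (mem_closedBall_zero_iff.2 (norm_le_one_of_sq_le (by linarith)))
  · intro x hx
    have := hts x hx
    simp only [disc, mem_ofPred_eq]
    linarith
  · intro h
    have := hone 0 (by simpa using ha)
    simp [h] at this
  · by_contra hlt
    have hopen : IsOpen {x : ℝ × ℝ | x.1 ^ 2 + x.2 ^ 2 < a} :=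
      isOpen_lt (by fun_prop) continuous_const
    have hev : v =ᶠ[𝓝 x] fun _ => 1 :=
      Filter.mem_of_superset (hopen.mem_nhds (not_le.1 hlt)) hone
    apply hx
    simp [cr, pd1, pd2, hev.fderiv_eq]
  · by_contra hlt
    exact hx (cr_eq_zero_of_notMem_tsupport fun h => hlt (hts x h))

theorem exists_pauliRayleigh_le {τ : ℝ} (hτ : τ ^ 2 = 1) {ψ : ℝ × ℝ → ℝ}
    (hψ : ContDiff ℝ (⊤ : ℕ∞) ψ) {g : ℝ → ℝ} (hg : Continuous g)
    (hψg : ∀ x, ψ x = g (x.1 ^ 2 + x.2 ^ 2)) {s₀ s₁ ε : ℝ} (h1 : 0 ≤ s₁) (h10 : s₁ < s₀)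
    (h0 : s₀ ≤ 1) (hε : 0 < ε) :
    ∃ C > 0, ∀ h > 0, ∃ u, IsTestFun (disc 1) u ∧
      pauliRayleigh (-τ) h (perpGrad ψ) (lap ψ) (disc 1) u
        ≤ C * h ^ 2 * Real.exp (-2 * (τ * g s₀ - τ * g s₁ - ε) / h) := by
  have hnear : ∀ᶠ t in 𝓝 s₀, τ * g s₀ - ε / 2 < τ * g t :=
    (show Continuous fun t => τ * g t from continuous_const.mul hg).continuousAt.eventually
      (lt_mem_nhds (show τ * g s₀ - ε / 2 < τ * g s₀ by linarith))
  obtain ⟨δ, hδ, hnear⟩ := Metric.eventually_nhds_iff.1 hnear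
  set a := max ((s₁ + s₀) / 2) (s₀ - δ / 2)
  have ha0 : a < s₀ := max_lt (by linarith) (by linarith)
  have ha1 : s₁ < a := lt_max_of_lt_left (by linarith)
  have haδ : s₀ - δ / 2 ≤ a := le_max_right _ _
  obtain ⟨v, hv, hv1, hcr⟩ := exists_radial_cutoff (a := a) (b := (a + s₀) / 2)
    (by linarith) (by linarith) (by linarith)
  set U : Set (ℝ × ℝ) := {x | x.1 ^ 2 + x.2 ^ 2 < a ∧
    τ * g (x.1 ^ 2 + x.2 ^ 2) < τ * g s₁ + ε / 2}
  have hUo : IsOpen U := by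
    have o1 : IsOpen {x : ℝ × ℝ | x.1 ^ 2 + x.2 ^ 2 < a} :=
      isOpen_lt (by fun_prop) continuous_const
    have o2 : IsOpen {x : ℝ × ℝ | τ * g (x.1 ^ 2 + x.2 ^ 2) < τ * g s₁ + ε / 2} :=
      isOpen_lt (by fun_prop) continuous_const
    exact o1.inter o2
  have hUne : U.Nonempty := ⟨(√s₁, 0), by simp [U, Real.sq_sqrt h1, ha1, hε]⟩
  have hUfin : volume U < ⊤ :=
    (measure_mono fun x hx => mem_closedBall_zero_iff.2
      (norm_le_one_of_sq_le (by linarith [hx.1]))).trans_lt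
      (isCompact_closedBall (0 : ℝ × ℝ) 1).measure_lt_top
  have hUpos : 0 < volume.real U :=
    ENNReal.toReal_pos (hUo.measure_pos volume hUne).ne' hUfin.ne
  have hI : 0 ≤ ∫ x, ‖cr τ v x‖ ^ 2 := integral_nonneg fun x => by positivity
  refine ⟨(∫ x, ‖cr τ v x‖ ^ 2) / volume.real U + 1, by positivity, fun h hh =>
    ⟨expTwist h (fun y => τ * ψ y) v, hv.expTwist h (contDiff_const.mul hψ), ?_⟩⟩
  refine (pauliRayleigh_expTwist_le (a := τ * g s₀ - ε / 2) (b := τ * g s₁ + ε / 2) hτ hh hψ hv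
    hUo.measurableSet hUpos (fun x hx => hv1 x hx.1) (fun x hx => ?_) (fun x hx => ?_)).trans ?_
  · rw [hψg]
    exact hx.2.le
  · rw [hψg]
    obtain ⟨l, r⟩ := hcr τ x hx
    exact (hnear (by rw [Real.dist_eq, abs_lt]; constructor <;> linarith)).le
  · rw [show τ * g s₀ - ε / 2 - (τ * g s₁ + ε / 2) = τ * g s₀ - τ * g s₁ - ε by ring]
    gcongr
    linarith

theorem tendsto_mul_log_sq_mul_exp {C : ℝ} (hC : 0 < C) (D : ℝ) :
    Tendsto (fun h : ℝ => h * Real.log (C * h ^ 2 * Real.exp (-2 * D / h))) (𝓝[>] 0)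
      (𝓝 (-2 * D)) := by
  have h0 : Tendsto (fun h : ℝ => h * Real.log h) (𝓝[>] 0) (𝓝 0) := by
    simpa using (Real.continuous_mul_log.tendsto 0).mono_left (nhdsWithin_le_nhds (s := Ioi 0))
  have h1 : Tendsto (fun h : ℝ => h * Real.log C + 2 * (h * Real.log h) + -2 * D) (𝓝[>] 0)
      (𝓝 (0 * Real.log C + 2 * 0 + -2 * D)) :=
    (((tendsto_id.mono_left nhdsWithin_le_nhds).mul_const _).add
      (h0.const_mul 2)).add_const _
  simp only [zero_mul, mul_zero, zero_add] at h1
  refine h1.congr' ?_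
  filter_upwards [self_mem_nhdsWithin] with h hh
  have hh : 0 < h := hh
  rw [Real.log_mul (by positivity) (by positivity), Real.log_mul (by positivity) (by positivity),
    Real.log_exp, Real.log_pow]
  field_simp
  push_cast
  ring

theorem tendsto_mul_log_LambdaD {τ : ℝ} (hτ : τ = 1 ∨ τ = -1) {ψ : ℝ × ℝ → ℝ}
    (hψ : ContDiff ℝ (⊤ : ℕ∞) ψ) {g : ℝ → ℝ} (hg : Continuous g)
    (hψg : ∀ x, ψ x = g (x.1 ^ 2 + x.2 ^ 2)) {s₀ s₁ m M : ℝ} (h1 : 0 ≤ s₁) (h10 : s₁ < s₀)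
    (h0 : s₀ ≤ 1) (hm : ∀ t, 0 ≤ t → t ≤ 1 → m ≤ g t) (hM : ∀ t, 0 ≤ t → t ≤ 1 → g t ≤ M)
    (hD : τ * g s₀ - τ * g s₁ = M - m) :
    Tendsto (fun h : ℝ => h * Real.log (LambdaD h (perpGrad ψ) (lap ψ) (disc 1))) (𝓝[>] 0)
      (𝓝 (-2 * (M - m))) := by
  have hτ2 : τ ^ 2 = 1 := by rcases hτ with rfl | rfl <;> norm_num
  have hd : ∀ x ∈ disc 1, x.1 ^ 2 + x.2 ^ 2 ≤ 1 := fun x hx => by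
    simp only [disc, mem_ofPred_eq] at hx
    linarith
  have hd' : ∀ x ∈ disc 1, x.1 ^ 2 ≤ 1 := fun x hx => by
    nlinarith [hd x hx, sq_nonneg x.2]
  have hmψ : ∀ x ∈ disc 1, m ≤ ψ x := fun x hx => by
    rw [hψg]; exact hm _ (by positivity) (hd x hx)
  have hMψ : ∀ x ∈ disc 1, ψ x ≤ M := fun x hx => by
    rw [hψg]; exact hM _ (by positivity) (hd x hx)
  have lbm : ∀ h > 0, ∀ u, IsTestFun (disc 1) u → h ^ 2 / 4 * Real.exp (-2 * (M - m) / h)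
      ≤ pauliRayleigh (-1) h (perpGrad ψ) (lap ψ) (disc 1) u := fun h hh u hu =>
    le_pauliRayleigh (τ := 1) (by norm_num) hh hψ hd' (fun x hx => by linarith [hmψ x hx])
      (fun x hx => by linarith [hMψ x hx]) hu
  have lbp : ∀ h > 0, ∀ u, IsTestFun (disc 1) u → h ^ 2 / 4 * Real.exp (-2 * (M - m) / h)
      ≤ pauliRayleigh 1 h (perpGrad ψ) (lap ψ) (disc 1) u := fun h hh u hu => by
    have := le_pauliRayleigh (τ := -1) (m := -M) (M := -m) (by norm_num) hh hψ hd'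
      (fun x hx => by linarith [hMψ x hx]) (fun x hx => by linarith [hmψ x hx]) hu
    rwa [neg_neg, neg_sub_neg] at this
  have hne : ∃ u, IsTestFun (disc 1) u := by
    obtain ⟨v, hv, -⟩ := exists_radial_cutoff (a := 1 / 4) (b := 1 / 2) (by norm_num)
      (by norm_num) (by norm_num)
    exact ⟨v, hv⟩
  have lower : ∀ h > 0, 1 / 4 * h ^ 2 * Real.exp (-2 * (M - m) / h)
      ≤ LambdaD h (perpGrad ψ) (lap ψ) (disc 1) := fun h hh => by
    rw [show 1 / 4 * h ^ 2 = h ^ 2 / 4 by ring]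
    refine le_min (le_csInf ?_ ?_) (le_csInf ?_ ?_)
    · exact Set.Nonempty.image _ hne
    · rintro _ ⟨u, hu, rfl⟩
      exact lbm h hh u hu
    · exact Set.Nonempty.image _ hne
    · rintro _ ⟨u, hu, rfl⟩
      exact lbp h hh u hu
  have upper : ∀ h > 0, ∀ u, IsTestFun (disc 1) u → LambdaD h (perpGrad ψ) (lap ψ) (disc 1)
      ≤ pauliRayleigh (-τ) h (perpGrad ψ) (lap ψ) (disc 1) u := fun h hh u hu => by
    rcases hτ with rfl | rfl
    · exact (min_le_left _ _).trans
        (csInf_le ⟨_, by rintro _ ⟨w, hw, rfl⟩; exact lbm h hh w hw⟩ ⟨u, hu, rfl⟩)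
    · rw [neg_neg]
      exact (min_le_right _ _).trans
        (csInf_le ⟨_, by rintro _ ⟨w, hw, rfl⟩; exact lbp h hh w hw⟩ ⟨u, hu, rfl⟩)
  refine tendsto_order.2 ⟨fun y hy => ?_, fun y hy => ?_⟩
  · filter_upwards [(tendsto_mul_log_sq_mul_exp (C := 1 / 4) (by norm_num)
      (M - m)).eventually (lt_mem_nhds hy), self_mem_nhdsWithin] with h hlt hh
    have hh : 0 < h := hh
    exact hlt.trans_le (mul_le_mul_of_nonneg_left
      (Real.log_le_log (by positivity) (lower h hh)) hh.le)
  · obtain ⟨C, hC, hu⟩ := exists_pauliRayleigh_le hτ2 hψ hg hψg h1 h10 h0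
      (ε := (y + 2 * (M - m)) / 4) (by linarith)
    rw [hD] at hu
    filter_upwards [(tendsto_mul_log_sq_mul_exp hC
      (M - m - (y + 2 * (M - m)) / 4)).eventually (gt_mem_nhds
        (show -2 * (M - m - (y + 2 * (M - m)) / 4) < y by linarith [hy])),
      self_mem_nhdsWithin] with h hlt hh
    have hh : 0 < h := hh
    obtain ⟨u, hut, hur⟩ := hu h hh
    refine lt_of_le_of_lt (mul_le_mul_of_nonneg_left (Real.log_le_log ?_ ?_) hh.le) hlt
    · exact lt_of_lt_of_le (by positivity) (lower h hh)
    · exact (upper h hh u hut).trans hur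

theorem lap_radial_example (β : ℝ) (x : ℝ × ℝ) :
    lap (fun x : ℝ × ℝ =>
      (1 / 16) * (x.1 ^ 2 + x.2 ^ 2 + 1 - 4 * β ^ 2) * (1 - x.1 ^ 2 - x.2 ^ 2)) x
      = β ^ 2 - (x.1 ^ 2 + x.2 ^ 2) := by
  set ψ : ℝ × ℝ → ℝ := fun x =>
    (1 / 16) * (x.1 ^ 2 + x.2 ^ 2 + 1 - 4 * β ^ 2) * (1 - x.1 ^ 2 - x.2 ^ 2)
  have hfst := fun y : ℝ × ℝ => hasFDerivAt_fst (𝕜 := ℝ) (p := y)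
  have hsnd := fun y : ℝ × ℝ => hasFDerivAt_snd (𝕜 := ℝ) (p := y)
  have hψ : ∀ y, HasFDerivAt ψ _ y := fun y =>
    ((((((hfst y).pow 2).add ((hsnd y).pow 2)).add_const 1).sub_const (4 * β ^ 2)).const_mul
      (1 / 16)).mul ((((hfst y).pow 2).const_sub 1).sub ((hsnd y).pow 2))
  have e1 : pd1 ψ = fun y => (1 / 4) * (y.1 * (2 * β ^ 2 - (y.1 ^ 2 + y.2 ^ 2))) := by
    ext1 y
    rw [pd1, (hψ y).fderiv]
    simp
    ring
  have e2 : pd2 ψ = fun y => (1 / 4) * (y.2 * (2 * β ^ 2 - (y.1 ^ 2 + y.2 ^ 2))) := by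
    ext1 y
    rw [pd2, (hψ y).fderiv]
    simp
    ring
  have hr := ((((hfst x).pow 2).add ((hsnd x).pow 2)).const_sub (2 * β ^ 2))
  have h1 : HasFDerivAt (pd1 ψ) _ x := e1 ▸ ((hfst x).mul hr).const_mul (1 / 4)
  have h2 : HasFDerivAt (pd2 ψ) _ x := e2 ▸ ((hsnd x).mul hr).const_mul (1 / 4)
  rw [lap, pd1, pd2, h1.fderiv, h2.fderiv]
  simp
  ring

end Radial

/-- Example 5.2: for `B_β = β² − r²` on the unit disc, the explicit
radial scalar potential and the three regimes for `lim_{h→0⁺} h·log Λ^D`. -/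
theorem pauli_full_lim_radial_example (β : ℝ) (hβ : 0 < β ∧ β < 1)
    (B ψ₀ : ℝ × ℝ → ℝ)
    (hB : B = fun x => β ^ 2 - (x.1 ^ 2 + x.2 ^ 2))
    (hψdef : ψ₀ = fun x =>
      (1 / 16) * (x.1 ^ 2 + x.2 ^ 2 + 1 - 4 * β ^ 2) * (1 - x.1 ^ 2 - x.2 ^ 2)) :
    (∀ x ∈ disc 1, lap ψ₀ x = B x) ∧
    (∀ x ∈ frontier (disc 1), ψ₀ x = 0) ∧
    (β ∈ Ioo (0 : ℝ) (1 / 2) →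
      Tendsto (fun h : ℝ => h * Real.log (LambdaD h (perpGrad ψ₀) B (disc 1))) (𝓝[>] 0)
        (𝓝 (-((1 / 8) * (2 * β ^ 2 - 1) ^ 2)))) ∧
    (β ∈ Icc (1 / 2) (1 / Real.sqrt 2) →
      Tendsto (fun h : ℝ => h * Real.log (LambdaD h (perpGrad ψ₀) B (disc 1))) (𝓝[>] 0)
        (𝓝 (-((1 / 2) * β ^ 4)))) ∧
    (β ∈ Ioo (1 / Real.sqrt 2) 1 →
      Tendsto (fun h : ℝ => h * Real.log (LambdaD h (perpGrad ψ₀) B (disc 1))) (𝓝[>] 0)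
        (𝓝 (-((1 / 8) * (4 * β ^ 2 - 1))))) := by
  obtain ⟨hβ0, hβ1⟩ := hβ
  have hlap : B = lap ψ₀ := by
    ext1 x
    rw [hB, hψdef, lap_radial_example]
  have hψ : ContDiff ℝ (⊤ : ℕ∞) ψ₀ := by
    rw [hψdef]
    fun_prop
  set g : ℝ → ℝ := fun t => (1 / 16) * (t + 1 - 4 * β ^ 2) * (1 - t) with hg
  have hgc : Continuous g := by fun_prop
  have hψg : ∀ x, ψ₀ x = g (x.1 ^ 2 + x.2 ^ 2) := fun x => by
    rw [hψdef, hg]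
    ring
  refine ⟨fun x _ => by rw [hlap], fun x hx => ?_, fun h => ?_, fun h => ?_, fun h => ?_⟩
  · have hx' : x.1 ^ 2 + x.2 ^ 2 = 1 ^ 2 :=
      frontier_lt_subset_eq (f := fun y : ℝ × ℝ => y.1 ^ 2 + y.2 ^ 2) (g := fun _ => 1 ^ 2)
        (by fun_prop) continuous_const hx
    rw [hψg, hx']
    simp [hg]
  · have hβ2 : β ^ 2 < 1 / 4 := by nlinarith [h.2]
    have := tendsto_mul_log_LambdaD (τ := -1) (Or.inr rfl) hψ hgc hψg (s₀ := 1) (s₁ := 2 * β ^ 2)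
      (m := 0) (M := (1 - 2 * β ^ 2) ^ 2 / 16) (by positivity) (by linarith) le_rfl
      (fun t ht0 ht1 => mul_nonneg (by linarith) (by linarith))
      (fun t ht0 ht1 => by simp only [hg]; nlinarith [sq_nonneg (t - 2 * β ^ 2)])
      (by simp only [hg]; ring)
    rw [hlap]
    convert this using 2
    ring
  · have hβ2 : 1 / 4 ≤ β ^ 2 := by nlinarith [h.1]
    have hβ3 : β ^ 2 ≤ 1 / 2 := by
      have h2 := h.2
      rw [le_div_iff₀ (by positivity)] at h2
      have h3 := Real.sq_sqrt (show (0 : ℝ) ≤ 2 by norm_num)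
      have h4 : (β * √2) ^ 2 ≤ 1 := pow_le_one₀ (by positivity) h2
      rw [mul_pow, h3] at h4
      linarith
    have := tendsto_mul_log_LambdaD (τ := 1) (Or.inl rfl) hψ hgc hψg (s₀ := 2 * β ^ 2) (s₁ := 0)
      (m := (1 - 4 * β ^ 2) / 16) (M := (1 - 2 * β ^ 2) ^ 2 / 16) le_rfl (by positivity)
      (by linarith)
      (fun t ht0 ht1 => by
        simp only [hg]
        nlinarith [mul_nonneg ht0 (show 0 ≤ 4 * β ^ 2 - t by linarith)])
      (fun t ht0 ht1 => by simp only [hg]; nlinarith [sq_nonneg (t - 2 * β ^ 2)])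
      (by simp only [hg]; ring)
    rw [hlap]
    convert this using 2
    ring
  · have hβ3 : 1 / 2 < β ^ 2 := by
      have h2 := h.1
      rw [div_lt_iff₀ (by positivity)] at h2
      have h3 := Real.sq_sqrt (show (0 : ℝ) ≤ 2 by norm_num)
      have h4 : 1 < (β * √2) ^ 2 := one_lt_pow₀ h2 (by norm_num)
      rw [mul_pow, h3] at h4
      linarith
    have := tendsto_mul_log_LambdaD (τ := 1) (Or.inl rfl) hψ hgc hψg (s₀ := 1) (s₁ := 0)
      (m := (1 - 4 * β ^ 2) / 16) (M := 0) le_rfl one_pos le_rfl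
      (fun t ht0 ht1 => by
        simp only [hg]
        nlinarith [mul_nonneg ht0 (show 0 ≤ 4 * β ^ 2 - t by linarith)])
      (fun t ht0 ht1 => mul_nonpos_of_nonpos_of_nonneg (by linarith) (by linarith))
      (by simp only [hg]; ring)
    rw [hlap]
    convert this using 2
    ring
end

section
/- Let Ω ⊂ ℝ² be a bounded, open, simply connected domain satisfying Assumption (R), and let ψ₀ be the scalar potential of B, with ψ₀ of class C¹ up to the boundary away from the corners. Assume ψ₀ ≤ 0 in Ω. Then for every h > 0, setting v := 1 − e^{2ψ₀/h}, one has h²∫_Ω e^{−2ψ₀/h}·|(∂₁ + i∂₂)v|² dx ≤ 4h·∫_Ω |B(x)| dx. -/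
open MeasureTheory Set Filter Topology

/-- A `C¹` approximation `p` of the positive part, vanishing on `(-∞, δ]`, with derivative `χ`. -/
theorem exists_approx_posPart {δ : ℝ} (hδ : 0 < δ) :
    ∃ p χ : ℝ → ℝ, (∀ t, HasDerivAt p (χ t) t) ∧ Continuous χ ∧ (∀ t, 0 ≤ χ t) ∧
      (∀ t, χ t ≤ 1) ∧ (∀ t, 2 * δ ≤ t → χ t = 1) ∧ (∀ t, t ≤ δ → p t = 0) ∧
      ∀ t, |p t| ≤ |t| := by
  have hc : Continuous fun t : ℝ => Real.smoothTransition (t / δ - 1) :=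
    Real.smoothTransition.continuous.comp (by fun_prop)
  refine ⟨fun t => ∫ s in (0 : ℝ)..t, Real.smoothTransition (s / δ - 1),
    fun t => Real.smoothTransition (t / δ - 1),
    fun t => (hc.integral_hasStrictDerivAt 0 t).hasDerivAt, hc,
    fun t => Real.smoothTransition.nonneg _, fun t => Real.smoothTransition.le_one _,
    fun t ht => ?_, fun t ht => ?_, fun t => ?_⟩
  · apply Real.smoothTransition.one_of_one_le
    have : 2 ≤ t / δ := by rwa [le_div_iff₀ hδ]
    linarith
  · refine (intervalIntegral.integral_congr (g := fun _ => (0 : ℝ)) fun s hs => ?_).trans (by simp)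
    apply Real.smoothTransition.zero_of_nonpos
    have hs' : s ≤ δ := hs.2.trans (max_le hδ.le ht)
    have : s / δ ≤ 1 := by rwa [div_le_one hδ]
    linarith
  · have := intervalIntegral.norm_integral_le_of_norm_le_const (a := 0) (b := t) (C := 1)
      (f := fun s : ℝ => Real.smoothTransition (s / δ - 1)) fun s _ => by
        rw [Real.norm_of_nonneg (Real.smoothTransition.nonneg _)]
        exact Real.smoothTransition.le_one _
    simpa using this

/-- The extension by zero of `p(u) w` is `C¹` with compact support, if `u` vanishes on the boundary
and `p` vanishes on `(-∞, δ]` for some `δ > 0`. -/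
theorem contDiff_indicator_comp_mul {Ω : Set (ℝ × ℝ)} (hΩ : IsOpen Ω)
    (hb : Bornology.IsBounded Ω) {p : ℝ → ℝ} (hp : ContDiff ℝ 1 p) {δ : ℝ} (hδ : 0 < δ)
    (hp0 : ∀ t, t ≤ δ → p t = 0) {u w : ℝ × ℝ → ℝ} (huc : ContinuousOn u (closure Ω))
    (hu0 : ∀ x ∈ frontier Ω, u x = 0) (hu : ContDiffOn ℝ 1 u Ω) (hw : ContDiffOn ℝ 1 w Ω) :
    ContDiff ℝ 1 (Ω.indicator fun x => p (u x) * w x) ∧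
      HasCompactSupport (Ω.indicator fun x => p (u x) * w x) ∧
      tsupport (Ω.indicator fun x => p (u x) * w x) ⊆ Ω := by
  set K : Set (ℝ × ℝ) := closure Ω ∩ u ⁻¹' Ici δ with hK
  have hKc : IsCompact K :=
    hb.isCompact_closure.of_isClosed_subset
      (huc.preimage_isClosed_of_isClosed isClosed_closure isClosed_Ici) inter_subset_left
  have hKΩ : K ⊆ Ω := by
    rintro x ⟨hx, hxδ⟩
    by_contra hxΩ
    have h0 := hu0 x ⟨hx, by rwa [hΩ.interior_eq]⟩
    have : δ ≤ u x := hxδ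
    linarith
  have hz : ∀ x, x ∉ K → Ω.indicator (fun x => p (u x) * w x) x = 0 := by
    intro x hx
    by_cases hxΩ : x ∈ Ω
    · have : u x ≤ δ := by
        by_contra hlt
        exact hx ⟨subset_closure hxΩ, (not_le.1 hlt).le⟩
      simp [hp0 _ this]
    · simp [hxΩ]
  refine ⟨contDiff_iff_contDiffAt.2 fun x => ?_, HasCompactSupport.intro hKc hz,
    (closure_minimal (fun x hx => by_contra fun hxK => (Function.mem_support.1 hx) (hz x hxK)) hKc.isClosed).trans hKΩ⟩
  by_cases hx : x ∈ Ω
  · have h1 : ContDiffAt ℝ 1 (fun x => p (u x) * w x) x :=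
      (hp.contDiffAt.comp x (hu.contDiffAt (hΩ.mem_nhds hx))).mul (hw.contDiffAt (hΩ.mem_nhds hx))
    refine h1.congr_of_eventuallyEq ?_
    filter_upwards [hΩ.mem_nhds hx] with y hy
    simp [hy]
  · refine (contDiffAt_const (c := (0 : ℝ))).congr_of_eventuallyEq ?_
    filter_upwards [hKc.isClosed.isOpen_compl.mem_nhds fun hxK => hx (hKΩ hxK)] with y hy
    exact hz y hy

/-- A directional derivative of a compactly supported `C¹` function has vanishing integral. -/
theorem integral_fderiv_apply_eq_zero_s13 {F : ℝ × ℝ → ℝ} (hF : ContDiff ℝ 1 F)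
    (hs : HasCompactSupport F) (v : ℝ × ℝ) :
    Integrable (fun x => fderiv ℝ F x v) ∧ ∫ x, fderiv ℝ F x v = 0 := by
  have hint : Integrable (fun x => fderiv ℝ F x v) :=
    ((hF.continuous_fderiv one_ne_zero).clm_apply continuous_const).integrable_of_hasCompactSupport
      (hs.fderiv_apply (𝕜 := ℝ) v)
  refine ⟨hint, ?_⟩
  have := integral_mul_fderiv_eq_neg_fderiv_mul_of_integrable (𝕜 := ℝ) (μ := volume)
    (f := fun _ : ℝ × ℝ => (1 : ℝ)) (g := F) (v := v) (by simp) (by simpa using hint)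
    (by simpa using hF.continuous.integrable_of_hasCompactSupport hs)
    (fun x _ => differentiableAt_const _) (fun x _ => (hF.differentiable one_ne_zero) x)
  simpa using this

/-- A directional derivative of `p(u) w` has vanishing integral over `Ω`, if `u` vanishes on the
boundary and `p` vanishes on `(-∞, δ]` for some `δ > 0`. -/
theorem setIntegral_fderiv_comp_mul_eq_zero {Ω : Set (ℝ × ℝ)} (hΩ : IsOpen Ω)
    (hb : Bornology.IsBounded Ω) {p : ℝ → ℝ} (hp : ContDiff ℝ 1 p) {δ : ℝ} (hδ : 0 < δ)
    (hp0 : ∀ t, t ≤ δ → p t = 0) {u w : ℝ × ℝ → ℝ} (huc : ContinuousOn u (closure Ω))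
    (hu0 : ∀ x ∈ frontier Ω, u x = 0) (hu : ContDiffOn ℝ 1 u Ω) (hw : ContDiffOn ℝ 1 w Ω)
    (v : ℝ × ℝ) :
    IntegrableOn (fun x => fderiv ℝ (fun x => p (u x) * w x) x v) Ω ∧
      ∫ x in Ω, fderiv ℝ (fun x => p (u x) * w x) x v = 0 := by
  obtain ⟨hF, hs, hsub⟩ := contDiff_indicator_comp_mul hΩ hb hp hδ hp0 huc hu0 hu hw
  obtain ⟨hint, hzero⟩ := integral_fderiv_apply_eq_zero_s13 hF hs v
  have heq : ∀ x ∈ Ω, fderiv ℝ (Ω.indicator fun x => p (u x) * w x) x v =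
      fderiv ℝ (fun x => p (u x) * w x) x v := by
    intro x hx
    have : Ω.indicator (fun x => p (u x) * w x) =ᶠ[𝓝 x] fun x => p (u x) * w x := by
      filter_upwards [hΩ.mem_nhds hx] with y hy
      simp [hy]
    rw [this.fderiv_eq]
  refine ⟨hint.integrableOn.congr_fun heq hΩ.measurableSet, ?_⟩
  rw [← setIntegral_congr_fun hΩ.measurableSet heq, setIntegral_eq_integral_of_forall_compl_eq_zero,
    hzero]
  intro x hx
  rw [fderiv_of_notMem_tsupport ℝ fun hxt => hx (hsub hxt)]
  simp

/-- The integrand of the trial state energy, for `v = 1 - exp(2ψ/h)`. -/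
theorem exp_mul_norm_sq_dbar {ψ : ℝ × ℝ → ℝ} {x : ℝ × ℝ} (hψ : DifferentiableAt ℝ ψ x) (h : ℝ) :
    Real.exp (-2 * ψ x / h) *
        ‖pd1 (fun y => 1 - (Complex.exp ((2 * ψ y / h : ℝ) : ℂ))) x
          + Complex.I * pd2 (fun y => 1 - (Complex.exp ((2 * ψ y / h : ℝ) : ℂ))) x‖ ^ 2 =
      (2 / h) ^ 2 * (Real.exp (2 * ψ x / h) * (pd1 ψ x ^ 2 + pd2 ψ x ^ 2)) := by
  have hd : ∀ v, fderiv ℝ (fun y => 1 - (Complex.exp ((2 * ψ y / h : ℝ) : ℂ))) x v =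
      ((-(2 / h * Real.exp (2 * ψ x / h) * fderiv ℝ ψ x v) : ℝ) : ℂ) := by
    intro v
    have h1 : HasFDerivAt (fun y => 1 - Real.exp (2 / h * ψ y))
        (-(Real.exp (2 / h * ψ x) • ((2 / h) • fderiv ℝ ψ x))) x :=
      ((hψ.hasFDerivAt.const_mul (2 / h)).exp).const_sub 1
    have h2 := Complex.ofRealCLM.hasFDerivAt.comp x h1
    have h3 : (fun y => 1 - (Complex.exp ((2 * ψ y / h : ℝ) : ℂ))) =
        Complex.ofRealCLM ∘ fun y => 1 - Real.exp (2 / h * ψ y) := by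
      funext y
      simp [div_mul_eq_mul_div]
    rw [h3, h2.fderiv]
    simp [div_mul_eq_mul_div]
    ring
  unfold pd1 pd2
  rw [hd, hd, ← Complex.normSq_eq_norm_sq, mul_comm Complex.I, Complex.normSq_add_mul_I]
  have he : Real.exp (-2 * ψ x / h) * Real.exp (2 * ψ x / h) = 1 := by
    rw [← Real.exp_add, ← Real.exp_zero]
    congr 1
    ring
  linear_combination ((2 / h) ^ 2 * Real.exp (2 * ψ x / h) *
    (fderiv ℝ ψ x (1, 0) ^ 2 + fderiv ℝ ψ x (0, 1) ^ 2)) * he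

/-- The derivative of `p(1 - exp(2ψ/h)) w` in a given direction. -/
theorem fderiv_comp_one_sub_exp_mul {p : ℝ → ℝ} {p' : ℝ} {ψ w : ℝ × ℝ → ℝ} {x : ℝ × ℝ} {h : ℝ}
    (hp : HasDerivAt p p' (1 - Real.exp (2 * ψ x / h))) (hψ : DifferentiableAt ℝ ψ x)
    (hw : DifferentiableAt ℝ w x) (v : ℝ × ℝ) :
    fderiv ℝ (fun x => p (1 - Real.exp (2 * ψ x / h)) * w x) x v =
      p (1 - Real.exp (2 * ψ x / h)) * fderiv ℝ w x v -
        p' * (2 / h * Real.exp (2 * ψ x / h)) * fderiv ℝ ψ x v * w x := by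
  have h1 : HasFDerivAt (fun y => 1 - Real.exp (2 * ψ y / h))
      (-(Real.exp (2 * ψ x / h) • ((2 / h) • fderiv ℝ ψ x))) x := by
    have := ((hψ.hasFDerivAt.const_mul (2 / h)).exp).const_sub 1
    simpa only [div_mul_eq_mul_div] using this
  have h2 := (hp.comp_hasFDerivAt x h1).mul hw.hasFDerivAt
  have h3 : (fun x => p (1 - Real.exp (2 * ψ x / h)) * w x) =
      (p ∘ fun x => 1 - Real.exp (2 * ψ x / h)) * w := rfl
  rw [h3, h2.fderiv]
  simp
  ring

/-- Weighted Dirichlet energy of a scalar potential, tested with a cutoff near the boundary. -/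
theorem setIntegral_cutoff_energy_le {Ω : Set (ℝ × ℝ)} {B ψ : ℝ × ℝ → ℝ} (hΩ : IsOpen Ω)
    (hb : Bornology.IsBounded Ω) (hψ : IsScalarPotential Ω B ψ)
    (hB : IntegrableOn (fun x => |B x|) Ω)
    (hneg : ∀ x ∈ Ω, ψ x ≤ 0) {h : ℝ} (hh : 0 < h) {δ : ℝ} (hδ : 0 < δ) {p χ : ℝ → ℝ}
    (hp : ∀ t, HasDerivAt p (χ t) t) (hχ : Continuous χ) (hp0 : ∀ t, t ≤ δ → p t = 0)
    (hpt : ∀ t, |p t| ≤ |t|)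
    (hint : IntegrableOn (fun x => χ (1 - Real.exp (2 * ψ x / h)) *
      (Real.exp (2 * ψ x / h) * (pd1 ψ x ^ 2 + pd2 ψ x ^ 2))) Ω) :
    ∫ x in Ω, χ (1 - Real.exp (2 * ψ x / h)) *
      (Real.exp (2 * ψ x / h) * (pd1 ψ x ^ 2 + pd2 ψ x ^ 2)) ≤ h / 2 * ∫ x in Ω, |B x| := by
  have hpc : ContDiff ℝ 1 p :=
    contDiff_one_iff_deriv.2 ⟨fun t => (hp t).differentiableAt, by
      rwa [show deriv p = χ from funext fun t => (hp t).deriv]⟩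
  have huc : ContinuousOn (fun x => 1 - Real.exp (2 * ψ x / h)) (closure Ω) := by
    have := hψ.contOn
    fun_prop
  have hu : ContDiffOn ℝ 1 (fun x => 1 - Real.exp (2 * ψ x / h)) Ω := by
    have := hψ.c2.of_le one_le_two
    fun_prop
  have hu0 : ∀ x ∈ frontier Ω, 1 - Real.exp (2 * ψ x / h) = 0 := fun x hx => by
    simp [hψ.bdry x hx]
  have hw : ∀ v, ContDiffOn ℝ 1 (fun x => fderiv ℝ ψ x v) Ω := fun v =>
    (hψ.c2.fderiv_of_isOpen hΩ (by norm_num)).clm_apply contDiffOn_const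
  obtain ⟨hi1, hz1⟩ := setIntegral_fderiv_comp_mul_eq_zero hΩ hb hpc hδ hp0 huc hu0 hu
    (hw (1, 0)) (1, 0)
  obtain ⟨hi2, hz2⟩ := setIntegral_fderiv_comp_mul_eq_zero hΩ hb hpc hδ hp0 huc hu0 hu
    (hw (0, 1)) (0, 1)
  have hsum := integral_add hi1 hi2
  rw [hz1, hz2, add_zero] at hsum
  have hi12 := Integrable.fun_add hi1 hi2
  have hmono := setIntegral_mono_on (hint.add (hi12.const_mul (h / 2)))
    (hB.const_mul (h / 2)) hΩ.measurableSet fun x hx => ?_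
  · simp only [Pi.add_apply] at hmono
    rw [integral_add hint (hi12.const_mul (h / 2)), integral_const_mul,
      integral_const_mul] at hmono
    rwa [hsum, mul_zero, add_zero] at hmono
  · have hψd : DifferentiableAt ℝ ψ x :=
      (hψ.c2.contDiffAt (hΩ.mem_nhds hx)).differentiableAt two_ne_zero
    have hwd : ∀ v, DifferentiableAt ℝ (fun x => fderiv ℝ ψ x v) x := fun v =>
      ((hw v).contDiffAt (hΩ.mem_nhds hx)).differentiableAt one_ne_zero
    have hlap : fderiv ℝ (fun x => fderiv ℝ ψ x (1, 0)) x (1, 0) +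
        fderiv ℝ (fun x => fderiv ℝ ψ x (0, 1)) x (0, 1) = B x := hψ.lap_eq x hx
    simp only [Pi.add_apply, fderiv_comp_one_sub_exp_mul (hp _) hψd (hwd _), pd1, pd2]
    have hu1 : |1 - Real.exp (2 * ψ x / h)| ≤ 1 := by
      have h1 : Real.exp (2 * ψ x / h) ≤ 1 := Real.exp_le_one_iff.2
        (div_nonpos_of_nonpos_of_nonneg (by linarith [hneg x hx]) hh.le)
      rw [abs_le]
      constructor <;> linarith [Real.exp_pos (2 * ψ x / h)]
    have hpB : p (1 - Real.exp (2 * ψ x / h)) * B x ≤ |B x| := by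
      refine (le_abs_self _).trans ?_
      rw [abs_mul]
      exact mul_le_of_le_one_left (abs_nonneg _) ((hpt _).trans hu1)
    rw [← hlap] at hpB ⊢
    have := mul_le_mul_of_nonneg_left hpB (half_pos hh).le
    refine le_trans (le_of_eq ?_) this
    field_simp
    ring

/-- Weighted Dirichlet energy of a nonpositive scalar potential. -/
theorem setIntegral_energy_le {Ω : Set (ℝ × ℝ)} {B ψ : ℝ × ℝ → ℝ} (hΩ : IsOpen Ω)
    (hb : Bornology.IsBounded Ω) (hψ : IsScalarPotential Ω B ψ)
    (hB : IntegrableOn (fun x => |B x|) Ω) (hneg : ∀ x ∈ Ω, ψ x ≤ 0) {h : ℝ} (hh : 0 < h) :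
    ∫ x in Ω, Real.exp (2 * ψ x / h) * (pd1 ψ x ^ 2 + pd2 ψ x ^ 2) ≤
      h / 2 * ∫ x in Ω, |B x| := by
  by_cases hint : IntegrableOn
    (fun x => Real.exp (2 * ψ x / h) * (pd1 ψ x ^ 2 + pd2 ψ x ^ 2)) Ω
  swap
  · rw [integral_undef hint]
    exact mul_nonneg (half_pos hh).le (integral_nonneg fun x => abs_nonneg _)
  have hδ : ∀ n : ℕ, (0 : ℝ) < 1 / ((n : ℝ) + 1) := fun n => Nat.one_div_pos_of_nat
  choose p χ hp hχ hχ0 hχ1 hχe hp0 hpt using fun n => exists_approx_posPart (hδ n)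
  have huc : ContinuousOn (fun x => 1 - Real.exp (2 * ψ x / h)) Ω := by
    have := hψ.contOn.mono subset_closure
    fun_prop
  have hmeas : ∀ n, AEStronglyMeasurable (fun x => χ n (1 - Real.exp (2 * ψ x / h)))
      (volume.restrict Ω) := fun n =>
    ((hχ n).comp_continuousOn huc).aestronglyMeasurable hΩ.measurableSet
  have hle : ∀ n t, ‖χ n t‖ ≤ 1 := fun n t => by
    rw [Real.norm_of_nonneg (hχ0 n t)]
    exact hχ1 n t
  refine le_of_tendsto (tendsto_integral_of_dominated_convergence
    (F := fun n x => χ n (1 - Real.exp (2 * ψ x / h)) *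
      (Real.exp (2 * ψ x / h) * (pd1 ψ x ^ 2 + pd2 ψ x ^ 2)))
    (fun x => ‖Real.exp (2 * ψ x / h) * (pd1 ψ x ^ 2 + pd2 ψ x ^ 2)‖)
    (fun n => (hmeas n).mul hint.aestronglyMeasurable) hint.norm
    (fun n => ae_of_all _ fun x => ?_) ?_) (Eventually.of_forall fun n => ?_)
  · rw [norm_mul]
    exact mul_le_of_le_one_left (norm_nonneg _) (hle n _)
  · filter_upwards [ae_restrict_mem hΩ.measurableSet] with x hx
    rcases (hneg x hx).eq_or_lt with h0 | hlt
    · have hmax : IsLocalMax ψ x := by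
        filter_upwards [hΩ.mem_nhds hx] with y hy
        rw [h0]
        exact hneg y hy
      simp [pd1, pd2, hmax.fderiv_eq_zero]
    · have hpos : 0 < 1 - Real.exp (2 * ψ x / h) :=
        sub_pos.2 (Real.exp_lt_one_iff.2 (div_neg_of_neg_of_pos (by linarith) hh))
      refine tendsto_const_nhds.congr' ?_
      filter_upwards [tendsto_one_div_add_atTop_nhds_zero_nat.eventually
        (gt_mem_nhds (half_pos hpos))] with n hn
      rw [hχe n _ (by linarith), one_mul]
  · exact setIntegral_cutoff_energy_le hΩ hb hψ hB hneg hh (hδ n) (hp n) (hχ n) (hp0 n) (hpt n)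
      (hint.bdd_mul (hmeas n) (ae_of_all _ fun x => hle n _))

/-- estimate (3.2) / `eq:upbnd1`: if `ψ₀ ≤ 0` in `Ω` then, with
`v = 1 − e^{2ψ₀/h}`, `h²∫ e^{−2ψ₀/h} |(∂₁+i∂₂)v|² ≤ 4h ∫ |B|`. -/
theorem pauli_trial_state_estimate (Ω : Set (ℝ × ℝ)) (B ψ₀ : ℝ × ℝ → ℝ)
    (hR : AssumptionR Ω B) (hsc : SimplyConnectedSpace Ω)
    (hψ : IsScalarPotential Ω B ψ₀)
    (hC1bdry : ∃ S : Finset (ℝ × ℝ), ContDiffOn ℝ 1 ψ₀ (closure Ω \ ↑S))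
    (hneg : ∀ x ∈ Ω, ψ₀ x ≤ 0) (h : ℝ) (hh : 0 < h) :
    h ^ 2 * ∫ x in Ω, Real.exp (-2 * ψ₀ x / h) *
        ‖pd1 (fun y => 1 - (Complex.exp ((2 * ψ₀ y / h : ℝ) : ℂ))) x
          + Complex.I * pd2 (fun y => 1 - (Complex.exp ((2 * ψ₀ y / h : ℝ) : ℂ))) x‖ ^ 2
      ≤ 4 * h * ∫ x in Ω, |B x| := by
  have hΩ := hR.isOpen
  have hB : IntegrableOn (fun x => |B x|) Ω :=
    (hR.fieldCont.abs.integrableOn_compact hR.bounded.isCompact_closure).mono_set subset_closure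
  have hE := setIntegral_energy_le hΩ hR.bounded hψ hB hneg hh
  rw [setIntegral_congr_fun hΩ.measurableSet fun x hx => exp_mul_norm_sq_dbar
    ((hψ.c2.contDiffAt (hΩ.mem_nhds hx)).differentiableAt two_ne_zero) h, integral_const_mul,
    ← mul_assoc, ← mul_pow, mul_div_cancel₀ _ hh.ne']
  have hB0 : 0 ≤ h * ∫ x in Ω, |B x| :=
    mul_nonneg hh.le (integral_nonneg fun x => abs_nonneg _)
  linarith
end

section
/- Let D(0,1) ⊂ ℝ² be the open unit disc, let −1 < β < 1, and define ψ_β(x₁,x₂) = (1/8)·(x₁ − 2β)·(1 − x₁² − x₂²). Then: (i) Δψ_β = β − x₁ in D(0,1) and ψ_β = 0 on ∂D(0,1); (ii) max over closure(D(0,1)) of ψ_β equals ψ_β((2β+√(3+4β²))/3, 0) if −1 < β < 1/2 and equals 0 if 1/2 ≤ β < 1; (iii) min over closure(D(0,1)) of ψ_β equals 0 if −1 < β ≤ −1/2 and equals ψ_β((2β−√(3+4β²))/3, 0) if −1/2 < β < 1; consequently (iv) Osc ψ_β := max ψ_β − min ψ_β equals ψ_β((2β+√(3+4β²))/3, 0)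 for −1 < β ≤ −1/2, equals ψ_β((2β+√(3+4β²))/3, 0) − ψ_β((2β−√(3+4β²))/3, 0) for −1/2 < β < 1/2, and equals −ψ_β((2β−√(3+4β²))/3, 0) for 1/2 ≤ β < 1. -/
open MeasureTheory Set Filter Topology

/-- The scalar potential of the affine field `β - x₁` on the unit disc. -/
noncomputable def affinePotential (β : ℝ) (x : ℝ × ℝ) : ℝ :=
  (1 / 8) * (x.1 - 2 * β) * (1 - x.1 ^ 2 - x.2 ^ 2)

theorem isOpen_disc (R : ℝ) : IsOpen (disc R) :=
  isOpen_lt (f := fun y : ℝ × ℝ => y.1 ^ 2 + y.2 ^ 2) (by fun_prop) continuous_const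

theorem closure_disc_subset (R : ℝ) :
    closure (disc R) ⊆ {y : ℝ × ℝ | y.1 ^ 2 + y.2 ^ 2 ≤ R ^ 2} :=
  closure_minimal (ofPred_subset_ofPred.2 fun _ hy => hy.le)
    (isClosed_le (by fun_prop) continuous_const)

theorem sq_add_sq_eq_of_mem_frontier_disc {R : ℝ} {x : ℝ × ℝ} (hx : x ∈ frontier (disc R)) :
    x.1 ^ 2 + x.2 ^ 2 = R ^ 2 := by
  rw [(isOpen_disc R).frontier_eq] at hx
  exact le_antisymm (closure_disc_subset R hx.1) (not_lt.mp hx.2)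

theorem mk_zero_mem_closure_disc_one {t : ℝ} (h1 : -1 ≤ t) (h2 : t ≤ 1) :
    (t, (0 : ℝ)) ∈ closure (disc 1) := by
  have hsub : (fun t : ℝ => (t, (0 : ℝ))) '' Ioo (-1) 1 ⊆ disc 1 := by
    rintro _ ⟨u, ⟨hu1, hu2⟩, rfl⟩
    change u ^ 2 + (0 : ℝ) ^ 2 < 1 ^ 2
    nlinarith
  refine closure_mono hsub (image_closure_subset_closure_image (by fun_prop) ⟨t, ?_, rfl⟩)
  rw [closure_Ioo (by norm_num)]
  exact ⟨h1, h2⟩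

theorem lap_affinePotential (β : ℝ) (x : ℝ × ℝ) : lap (affinePotential β) x = β - x.1 := by
  have hfst (x : ℝ × ℝ) : HasFDerivAt (fun y : ℝ × ℝ => y.1) (ContinuousLinearMap.fst ℝ ℝ ℝ) x :=
    hasFDerivAt_fst
  have hsnd (x : ℝ × ℝ) : HasFDerivAt (fun y : ℝ × ℝ => y.2) (ContinuousLinearMap.snd ℝ ℝ ℝ) x :=
    hasFDerivAt_snd
  have hψ (x : ℝ × ℝ) := (((hfst x).sub_const (2 * β)).const_mul (1 / 8)).mul
    ((((hfst x).pow 2).const_sub 1).sub ((hsnd x).pow 2))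
  have h1 : pd1 (affinePotential β) = fun x =>
      (1 / 8) * (1 - x.1 ^ 2 - x.2 ^ 2) - (1 / 4) * (x.1 - 2 * β) * x.1 := by
    funext x
    refine (congrArg (fun L : ℝ × ℝ →L[ℝ] ℝ => L (1, 0)) (hψ x).fderiv).trans ?_
    simp
    ring
  have h2 : pd2 (affinePotential β) = fun x => -((1 / 4) * (x.1 - 2 * β) * x.2) := by
    funext x
    refine (congrArg (fun L : ℝ × ℝ →L[ℝ] ℝ => L (0, 1)) (hψ x).fderiv).trans ?_
    simp
    ring
  have h11 := (((((hfst x).pow 2).const_sub 1).sub ((hsnd x).pow 2)).const_mul (1 / 8)).sub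
    ((((hfst x).sub_const (2 * β)).const_mul (1 / 4)).mul (hfst x))
  have h22 := ((((hfst x).sub_const (2 * β)).const_mul (1 / 4)).mul (hsnd x)).neg
  have e1 := congrArg (fun L : ℝ × ℝ →L[ℝ] ℝ => L (1, 0)) h11.fderiv
  have e2 := congrArg (fun L : ℝ × ℝ →L[ℝ] ℝ => L (0, 1)) h22.fderiv
  rw [lap, h1, h2]
  refine (congrArg₂ (· + ·) e1 e2).trans ?_
  simp
  ring

theorem affinePotential_neg (β : ℝ) (x : ℝ × ℝ) :
    affinePotential (-β) (-x) = -affinePotential β x := by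
  simp only [affinePotential, Prod.fst_neg, Prod.snd_neg]
  ring

theorem affinePotential_le {β : ℝ} {x : ℝ × ℝ} (hx : x.1 ^ 2 + x.2 ^ 2 ≤ 1) :
    affinePotential β x ≤ affinePotential β ((2 * β + √(3 + 4 * β ^ 2)) / 3, 0) := by
  obtain ⟨s, hs⟩ : ∃ s, s = (2 * β + √(3 + 4 * β ^ 2)) / 3 := ⟨_, rfl⟩
  have hsq : √(3 + 4 * β ^ 2) ^ 2 = 3 + 4 * β ^ 2 := Real.sq_sqrt (by positivity)
  have hs0 : 0 ≤ s := by
    have : -(2 * β) ≤ √(3 + 4 * β ^ 2) := Real.le_sqrt_of_sq_le (by nlinarith)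
    rw [hs]
    linarith
  have hcrit : 3 * s ^ 2 = 1 + 4 * β * s := by
    rw [hs]
    linear_combination hsq / 3
  have hfactor (t : ℝ) : affinePotential β (s, 0) - affinePotential β (t, 0)
      = (1 / 8) * ((t - s) ^ 2 * (t - 2 * β + 2 * s)) := by
    simp only [affinePotential]
    linear_combination (1 / 8) * (t - s) * hcrit
  rw [← hs]
  rcases le_total x.1 (2 * β) with h | h
  · have h1 : affinePotential β x ≤ 0 := by
      have := mul_nonneg (sub_nonneg.2 h) (sub_nonneg.2 hx)
      simp only [affinePotential]
      nlinarith
    have h2 : affinePotential β (2 * β, 0) = 0 := by simp [affinePotential]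
    have h3 := hfactor (2 * β)
    have h4 : 0 ≤ (2 * β - s) ^ 2 * (2 * β - 2 * β + 2 * s) :=
      mul_nonneg (sq_nonneg _) (by linarith)
    linarith
  · have h1 : affinePotential β x ≤ affinePotential β (x.1, 0) := by
      have := mul_nonneg (sub_nonneg.2 h) (sq_nonneg x.2)
      simp only [affinePotential]
      nlinarith
    have h3 := hfactor x.1
    have h4 : 0 ≤ (x.1 - s) ^ 2 * (x.1 - 2 * β + 2 * s) :=
      mul_nonneg (sq_nonneg _) (by linarith)
    linarith

theorem isGreatest_affinePotential {β : ℝ} (hβ : β ≤ 1 / 2) :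
    IsGreatest (affinePotential β '' closure (disc 1))
      (affinePotential β ((2 * β + √(3 + 4 * β ^ 2)) / 3, 0)) := by
  have h1 : -(2 * β) ≤ √(3 + 4 * β ^ 2) := Real.le_sqrt_of_sq_le (by nlinarith)
  have h2 : √(3 + 4 * β ^ 2) ≤ 3 - 2 * β := Real.sqrt_le_iff.2 ⟨by linarith, by nlinarith⟩
  refine ⟨mem_image_of_mem _ (mk_zero_mem_closure_disc_one (by linarith) (by linarith)), ?_⟩
  rintro _ ⟨x, hx, rfl⟩
  exact affinePotential_le (by simpa using closure_disc_subset 1 hx)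

theorem isGreatest_affinePotential_zero {β : ℝ} (hβ : 1 / 2 ≤ β) :
    IsGreatest (affinePotential β '' closure (disc 1)) 0 := by
  refine ⟨⟨(1, 0), mk_zero_mem_closure_disc_one (by norm_num) le_rfl,
    by simp [affinePotential]⟩, ?_⟩
  rintro _ ⟨x, hx, rfl⟩
  have hx' : x.1 ^ 2 + x.2 ^ 2 ≤ 1 := by simpa using closure_disc_subset 1 hx
  have h1 : x.1 ≤ 2 * β := by nlinarith [sq_nonneg x.2]
  have := mul_nonneg (sub_nonneg.2 h1) (sub_nonneg.2 hx')
  simp only [affinePotential]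
  nlinarith

theorem neg_mem_closure_disc {R : ℝ} {x : ℝ × ℝ} (hx : x ∈ closure (disc R)) :
    -x ∈ closure (disc R) :=
  map_mem_closure continuous_neg hx fun y hy => by simpa [disc] using hy

theorem IsGreatest.isLeast_affinePotential {β m : ℝ}
    (h : IsGreatest (affinePotential (-β) '' closure (disc 1)) m) :
    IsLeast (affinePotential β '' closure (disc 1)) (-m) := by
  obtain ⟨⟨x, hx, rfl⟩, hub⟩ := h
  refine ⟨⟨-x, neg_mem_closure_disc hx, by simpa using affinePotential_neg (-β) x⟩, ?_⟩
  rintro _ ⟨y, hy, rfl⟩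
  have := hub (mem_image_of_mem _ (neg_mem_closure_disc hy))
  rw [affinePotential_neg] at this
  linarith

theorem isLeast_affinePotential {β : ℝ} (hβ : -(1 / 2) ≤ β) :
    IsLeast (affinePotential β '' closure (disc 1))
      (affinePotential β ((2 * β - √(3 + 4 * β ^ 2)) / 3, 0)) := by
  convert (isGreatest_affinePotential (β := -β) (by linarith)).isLeast_affinePotential using 1
  rw [← affinePotential_neg, neg_neg, neg_sq, Prod.neg_mk, neg_zero]
  congr 2
  ring

theorem isLeast_affinePotential_zero {β : ℝ} (hβ : β ≤ -(1 / 2)) :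
    IsLeast (affinePotential β '' closure (disc 1)) 0 := by
  simpa using (isGreatest_affinePotential_zero (β := -β) (by linarith)).isLeast_affinePotential

/-- formulas (6.1)–(6.5): explicit scalar potential
`ψ_β = (1/8)(x₁−2β)(1−x₁²−x₂²)` for `B_β = β − x₁` on the unit disc, with its
maximum, minimum and oscillation over the closed disc in the various regimes of `β`. -/
theorem affine_field_scalar_potential (β : ℝ) (hβ : -1 < β ∧ β < 1)
    (ψβ : ℝ × ℝ → ℝ)
    (hψdef : ψβ = fun x => (1 / 8) * (x.1 - 2 * β) * (1 - x.1 ^ 2 - x.2 ^ 2)) :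
    (∀ x ∈ disc 1, lap ψβ x = β - x.1) ∧
    (∀ x ∈ frontier (disc 1), ψβ x = 0) ∧
    (β < 1 / 2 →
      sSup (ψβ '' closure (disc 1)) = ψβ ((2 * β + Real.sqrt (3 + 4 * β ^ 2)) / 3, 0)) ∧
    (1 / 2 ≤ β → sSup (ψβ '' closure (disc 1)) = 0) ∧
    (β ≤ -(1 / 2) → sInf (ψβ '' closure (disc 1)) = 0) ∧
    (-(1 / 2) < β →
      sInf (ψβ '' closure (disc 1)) = ψβ ((2 * β - Real.sqrt (3 + 4 * β ^ 2)) / 3, 0)) ∧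
    (β ≤ -(1 / 2) →
      osc ψβ (closure (disc 1)) = ψβ ((2 * β + Real.sqrt (3 + 4 * β ^ 2)) / 3, 0)) ∧
    (-(1 / 2) < β ∧ β < 1 / 2 →
      osc ψβ (closure (disc 1)) = ψβ ((2 * β + Real.sqrt (3 + 4 * β ^ 2)) / 3, 0)
        - ψβ ((2 * β - Real.sqrt (3 + 4 * β ^ 2)) / 3, 0)) ∧
    (1 / 2 ≤ β →
      osc ψβ (closure (disc 1)) = -ψβ ((2 * β - Real.sqrt (3 + 4 * β ^ 2)) / 3, 0)) := by
  obtain rfl : ψβ = affinePotential β := hψdef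
  have hmax (h : β ≤ 1 / 2) := (isGreatest_affinePotential h).csSup_eq
  have hmax' (h : 1 / 2 ≤ β) := (isGreatest_affinePotential_zero h).csSup_eq
  have hmin (h : -(1 / 2) ≤ β) := (isLeast_affinePotential h).csInf_eq
  have hmin' (h : β ≤ -(1 / 2)) := (isLeast_affinePotential_zero h).csInf_eq
  refine ⟨fun x _ => lap_affinePotential β x, fun x hx => ?_, fun h => hmax h.le, hmax', hmin',
    fun h => hmin h.le, fun h => ?_, fun h => ?_, fun h => ?_⟩
  · have := sq_add_sq_eq_of_mem_frontier_disc hx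
    simp only [affinePotential]
    linear_combination -(1 / 8) * (x.1 - 2 * β) * this
  · rw [osc, hmax (by linarith), hmin' h, sub_zero]
  · rw [osc, hmax h.2.le, hmin h.1.le]
  · rw [osc, hmax' h, hmin (by linarith), zero_sub]
end
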